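/- arXiv:1301.2213 — 3 statements merged into one kernel-verified Lean document; each statement's English description precedes it below -/
import Mathlib

section
/- Let A be a real associative algebra and let p be a seminorm on A satisfying the square property, i.e. p(a²) = p(a)² for all a ∈ A. Then p is submultiplicative: p(ab) ≤ p(a)·p(b) for all a, b ∈ A. -/
/-- The real quadratic polynomial `X² - 2αX + (α² + β²)`, with roots `α ± iβ`, evaluated at `x`. -/
def quadEval {R : Type*} [Ring R] [Algebra ℝ R] (z : ℂ) (x : R) : R :=
  x * x - (2 * z.re) • x + (z.re ^ 2 + z.im ^ 2) • (1 : R)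

section Domain

variable {D : Type*} [Ring D] [Algebra ℝ D] [Nontrivial D]

theorem eq_zero_of_smul_one {r : ℝ} (h : r • (1 : D) = 0) : r = 0 :=
  (smul_eq_zero.mp h).resolve_right one_ne_zero

theorem norm_sq_eq_of_quadEval_smul_one {z : ℂ} {r : ℝ} (h : quadEval z (r • (1 : D)) = 0) :
    z.re ^ 2 + z.im ^ 2 = r ^ 2 := by
  have h1 : ((r - z.re) ^ 2 + z.im ^ 2) • (1 : D) = 0 := by
    rw [← h, quadEval]
    simp only [smul_mul_assoc, mul_smul_comm, one_mul]
    module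
  have h2 := eq_zero_of_smul_one h1
  have h3 : z.im = 0 := by nlinarith [sq_nonneg (r - z.re), sq_nonneg z.im]
  have h4 : r - z.re = 0 := by nlinarith [sq_nonneg (r - z.re), sq_nonneg z.im]
  rw [h3, show r = z.re by linarith]; ring

theorem norm_sq_eq_of_quadEval {z w : ℂ} {x : D} (hz : quadEval z x = 0)
    (hw : quadEval w x = 0) : z.re ^ 2 + z.im ^ 2 = w.re ^ 2 + w.im ^ 2 := by
  have h : (2 * (z.re - w.re)) • x
      = (z.re ^ 2 + z.im ^ 2 - (w.re ^ 2 + w.im ^ 2)) • (1 : D) := by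
    rw [← sub_eq_zero, ← neg_eq_zero, ← sub_zero (0 : D)]
    nth_rw 1 [← hz]
    rw [← hw, quadEval, quadEval]
    module
  by_cases hzw : 2 * (z.re - w.re) = 0
  · rw [hzw, zero_smul] at h
    linarith [eq_zero_of_smul_one h.symm]
  · have hx : x = ((2 * (z.re - w.re))⁻¹ *
        (z.re ^ 2 + z.im ^ 2 - (w.re ^ 2 + w.im ^ 2))) • (1 : D) := by
      rw [mul_smul, ← h, smul_smul, inv_mul_cancel₀ hzw, one_smul]
    rw [hx] at hz hw
    exact (norm_sq_eq_of_quadEval_smul_one hz).trans (norm_sq_eq_of_quadEval_smul_one hw).symm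

variable [NoZeroDivisors D]

theorem exists_anticommutator_eq (hquad : ∀ x : D, ∃ z : ℂ, quadEval z x = 0) {u v : D} {s t : ℝ}
    (hu : u * u = -(s ^ 2) • (1 : D)) (hv : v * v = -(t ^ 2) • (1 : D)) :
    ∃ c : ℝ, u * v + v * u = c • (1 : D) := by
  obtain ⟨z, hz⟩ := hquad (u + v)
  have hz' : u * v + v * u = (2 * z.re) • (u + v)
      + (s ^ 2 + t ^ 2 - (z.re ^ 2 + z.im ^ 2)) • (1 : D) := by
    rw [← sub_eq_zero, ← hz, quadEval, mul_add, add_mul, add_mul, hu, hv]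
    module
  by_cases h0 : z.re = 0
  · exact ⟨_, by simpa [h0] using hz'⟩
  have hcomm : u * v = v * u := by
    have h1 : u * (u * v + v * u) = (u * v + v * u) * u := by
      have e1 : u * (u * v + v * u) = (u * u) * v + u * v * u := by noncomm_ring
      have e2 : (u * v + v * u) * u = u * v * u + v * (u * u) := by noncomm_ring
      rw [e1, e2, hu]
      simp only [smul_mul_assoc, mul_smul_comm, one_mul, mul_one]
      abel
    rw [hz'] at h1
    simp only [mul_add, add_mul, smul_mul_assoc, mul_smul_comm, one_mul, mul_one] at h1
    have h2 : (2 * z.re) • (u * v - v * u) = 0 := by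
      rw [← sub_eq_zero.mpr h1]
      module
    exact sub_eq_zero.mp ((smul_eq_zero.mp h2).resolve_left (by simpa using h0))
  have hprod : (t • u - s • v) * (t • u + s • v) = 0 := by
    simp only [mul_add, sub_mul, smul_mul_assoc, mul_smul_comm, hu, hv, hcomm]
    module
  by_cases hs : s = 0
  · have : u = 0 := by simpa [hs] using hu
    exact ⟨0, by simp [this]⟩
  · obtain ⟨k, hk⟩ : ∃ k : ℝ, v = k • u := by
      rcases mul_eq_zero.mp hprod with h | h
      · refine ⟨s⁻¹ * t, ?_⟩
        rw [mul_smul, sub_eq_zero.mp h, smul_smul, inv_mul_cancel₀ hs, one_smul]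
      · refine ⟨-(s⁻¹ * t), ?_⟩
        rw [neg_smul, mul_smul, eq_neg_of_add_eq_zero_left h, smul_neg, smul_smul,
          inv_mul_cancel₀ hs, one_smul, neg_neg]
    refine ⟨2 * k * -(s ^ 2), ?_⟩
    rw [hk, smul_mul_assoc, mul_smul_comm, hu]
    module

theorem norm_sq_mul_of_quadEval (hquad : ∀ x : D, ∃ z : ℂ, quadEval z x = 0) {a b : D}
    {z w y : ℂ} (ha : quadEval z a = 0) (hb : quadEval w b = 0) (hab : quadEval y (a * b) = 0) :
    y.re ^ 2 + y.im ^ 2 = (z.re ^ 2 + z.im ^ 2) * (w.re ^ 2 + w.im ^ 2) := by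
  obtain ⟨u, rfl⟩ : ∃ u, a = z.re • (1 : D) + u := ⟨a - z.re • (1 : D), by abel⟩
  obtain ⟨v, rfl⟩ : ∃ v, b = w.re • (1 : D) + v := ⟨b - w.re • (1 : D), by abel⟩
  have hu : u * u = -(z.im ^ 2) • (1 : D) := by
    rw [← sub_eq_zero, ← ha, quadEval]
    simp only [mul_add, add_mul, smul_mul_assoc, mul_smul_comm, one_mul, mul_one]
    module
  have hv : v * v = -(w.im ^ 2) • (1 : D) := by
    rw [← sub_eq_zero, ← hb, quadEval]
    simp only [mul_add, add_mul, smul_mul_assoc, mul_smul_comm, one_mul, mul_one]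
    module
  obtain ⟨c, hc⟩ := exists_anticommutator_eq hquad hu hv
  have ha' : (z.re • (1 : D) - u) * (z.re • (1 : D) + u) = (z.re ^ 2 + z.im ^ 2) • (1 : D) := by
    simp only [mul_add, sub_mul, smul_mul_assoc, mul_smul_comm, one_mul, mul_one, hu]
    module
  have hb' : (w.re • (1 : D) + v) * (w.re • (1 : D) - v) = (w.re ^ 2 + w.im ^ 2) • (1 : D) := by
    simp only [mul_sub, add_mul, smul_mul_assoc, mul_smul_comm, one_mul, mul_one, hv]
    module
  have ha'' : (z.re • (1 : D) + u) * (z.re • (1 : D) - u) = (z.re ^ 2 + z.im ^ 2) • (1 : D) := by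
    simp only [mul_sub, add_mul, smul_mul_assoc, mul_smul_comm, one_mul, mul_one, hu]
    module
  set a := z.re • (1 : D) + u with hadef
  set b := w.re • (1 : D) + v with hbdef
  set a' := z.re • (1 : D) - u with hadef'
  set b' := w.re • (1 : D) - v with hbdef'
  set N := z.re ^ 2 + z.im ^ 2 with hN
  set P := w.re ^ 2 + w.im ^ 2 with hP
  have hsum : a * b + b' * a' = (2 * z.re * w.re + c) • (1 : D) := by
    have : a * b + b' * a' = (2 * z.re * w.re) • (1 : D) + (u * v + v * u) := by
      simp only [hadef, hbdef, hadef', hbdef', mul_add, add_mul, mul_sub, sub_mul,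
        smul_mul_assoc, mul_smul_comm, one_mul, mul_one]
      module
    rw [this, hc]; module
  have hmul : (a * b) * (b' * a') = (N * P) • (1 : D) := by
    rw [show (a * b) * (b' * a') = a * (b * b') * a' by noncomm_ring, hb', mul_smul_comm, mul_one,
      smul_mul_assoc, ha'', smul_smul, mul_comm]
  have hsq : (a * b) * (a * b) = (2 * z.re * w.re + c) • (a * b) - (N * P) • (1 : D) := by
    rw [← hmul, eq_sub_iff_add_eq, ← mul_add, hsum, mul_smul_comm, mul_one]
  have hlin : (2 * z.re * w.re + c - 2 * y.re) • (a * b)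
      = (N * P - (y.re ^ 2 + y.im ^ 2)) • (1 : D) := by
    rw [quadEval, hsq] at hab
    rw [← sub_eq_zero, ← hab]
    module
  by_cases h0 : 2 * z.re * w.re + c - 2 * y.re = 0
  · rw [h0, zero_smul] at hlin
    linarith [eq_zero_of_smul_one hlin.symm]
  obtain ⟨r, hr⟩ : ∃ r : ℝ, a * b = r • (1 : D) := by
    refine ⟨(2 * z.re * w.re + c - 2 * y.re)⁻¹ * (N * P - (y.re ^ 2 + y.im ^ 2)), ?_⟩
    rw [mul_smul, ← hlin, smul_smul, inv_mul_cancel₀ h0, one_smul]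
  rw [hr] at hab
  rw [norm_sq_eq_of_quadEval_smul_one hab]
  by_cases hN0 : N = 0
  · have h1 : a' * (a * b) = 0 := by rw [← mul_assoc, ha', hN0, zero_smul, zero_mul]
    have h2 : a * a' = 0 := by rw [ha'', hN0, zero_smul]
    have h3 : a = 0 := by
      have hz0 : z.re = 0 := by nlinarith [sq_nonneg z.re, sq_nonneg z.im]
      have hz1 : z.im = 0 := by nlinarith [sq_nonneg z.re, sq_nonneg z.im]
      have hu0 : u = 0 := by simpa [hz1] using hu
      rw [hadef, hz0, hu0]; simp
    rw [h3, zero_mul] at hr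
    rw [hN0, eq_zero_of_smul_one hr.symm]; ring
  have hbval : b = (N⁻¹ * r) • a' := by
    have : N • b = r • a' := by
      rw [show N • b = (N • (1 : D)) * b by simp, ← ha', mul_assoc, hr, mul_smul_comm, mul_one]
    rw [mul_smul, ← this, smul_smul, inv_mul_cancel₀ hN0, one_smul]
  have hb2 : quadEval (((N⁻¹ * r : ℝ) : ℂ) * z) b = 0 := by
    have hsq' : a' * a' = (2 * z.re) • a' - N • (1 : D) := by
      rw [← ha', eq_sub_iff_add_eq, ← mul_add, show a' + a = (2 * z.re) • (1 : D) by
        rw [hadef, hadef']; module, mul_smul_comm, mul_one]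
    rw [quadEval, hbval]
    simp only [Complex.re_ofReal_mul, Complex.im_ofReal_mul, smul_mul_assoc, mul_smul_comm, hsq']
    rw [hN]
    module
  have := norm_sq_eq_of_quadEval hb hb2
  simp only [Complex.re_ofReal_mul, Complex.im_ofReal_mul] at this
  rw [hP, this, show (N⁻¹ * r * z.re) ^ 2 + (N⁻¹ * r * z.im) ^ 2 = (N⁻¹ * r) ^ 2 * N by
    rw [hN]; ring]
  field_simp

end Domain
open Filter Topology

theorem isUnit_algebraMap_sub_of_isUnit {S : Type*} [Ring S] [Algebra ℂ S] {T : S} {z : ℂ}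
    (h : IsUnit (T * T - (2 * z.re : ℂ) • T + (z.re ^ 2 + z.im ^ 2 : ℂ) • 1)) :
    IsUnit (algebraMap ℂ S z - T) := by
  have hc : Commute (algebraMap ℂ S z - T) (algebraMap ℂ S (star z) - T) :=
    Commute.sub_left (Algebra.commutes _ _)
      (Commute.sub_right (Algebra.commutes _ _).symm (Commute.refl _))
  have hmul : (algebraMap ℂ S z - T) * (algebraMap ℂ S (star z) - T)
      = T * T - (2 * z.re : ℂ) • T + (z.re ^ 2 + z.im ^ 2 : ℂ) • 1 := by
    have h1 : (2 * z.re : ℂ) = z + star z := by apply Complex.ext <;> simp; ring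
    have h2 : (z.re ^ 2 + z.im ^ 2 : ℂ) = z * star z := by
      apply Complex.ext <;> simp [← Complex.ofReal_pow] <;> ring
    rw [h1, h2]
    simp only [Algebra.algebraMap_eq_smul_one, mul_sub, sub_mul, smul_mul_assoc, mul_smul_comm,
      one_mul, mul_one]
    module
  rw [← hmul] at h
  exact (hc.isUnit_mul_iff.mp h).1

section Dual

variable {R : Type*} [NormedRing R] [NormedAlgebra ℝ R]

/-- The operator on `ℂ`-valued real functionals given by precomposition with right
multiplication by `x`. -/
noncomputable def dualMul (x : R) : (R →L[ℝ] ℂ) →L[ℂ] (R →L[ℝ] ℂ) :=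
  LinearMap.mkContinuous
    { toFun := fun f => f.comp ((ContinuousLinearMap.mul ℝ R).flip x)
      map_add' := fun f g => by ext; simp
      map_smul' := fun c f => by ext; simp } ‖x‖ (fun f => by
      refine ContinuousLinearMap.opNorm_le_bound _ (by positivity) fun y => ?_
      calc ‖f (y * x)‖ ≤ ‖f‖ * ‖y * x‖ := f.le_opNorm _
        _ ≤ ‖f‖ * (‖y‖ * ‖x‖) := by gcongr; exact norm_mul_le _ _
        _ = ‖x‖ * ‖f‖ * ‖y‖ := by ring)

@[simp]
theorem dualMul_apply (x : R) (f : R →L[ℝ] ℂ) (y : R) : dualMul x f y = f (y * x) := rfl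

theorem norm_dualMul_le (x : R) : ‖dualMul x‖ ≤ ‖x‖ :=
  LinearMap.mkContinuous_norm_le _ (norm_nonneg x) _

/-- The ring homomorphism of a real normed algebra into operators on a complex Banach space. -/
noncomputable def dualMulHom : R →+* ((R →L[ℝ] ℂ) →L[ℂ] (R →L[ℝ] ℂ)) where
  toFun := dualMul
  map_one' := by ext; simp
  map_mul' x y := by ext; simp [mul_assoc]
  map_zero' := by ext; simp
  map_add' x y := by ext; simp [mul_add]

theorem norm_le_norm_dualMul (x : R) : ‖x‖ ≤ ‖dualMul x‖ * ‖(1 : R)‖ := by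
  obtain ⟨g, hg, hgx⟩ := exists_dual_vector'' ℝ x
  have hn : ‖Complex.ofRealCLM.comp g‖ ≤ 1 := by
    refine ContinuousLinearMap.opNorm_le_bound _ zero_le_one fun y => ?_
    simpa using g.le_of_opNorm_le hg y
  have h1 : ‖dualMul x (Complex.ofRealCLM.comp g) 1‖ = ‖x‖ := by
    simp [hgx]
  calc ‖x‖ = ‖dualMul x (Complex.ofRealCLM.comp g) 1‖ := h1.symm
    _ ≤ ‖dualMul x (Complex.ofRealCLM.comp g)‖ * ‖(1 : R)‖ := ContinuousLinearMap.le_opNorm _ _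
    _ ≤ (‖dualMul x‖ * 1) * ‖(1 : R)‖ := by
        gcongr
        exact (ContinuousLinearMap.le_opNorm _ _).trans (by gcongr)
    _ = _ := by ring

theorem dualMulHom_quadEval (z : ℂ) (x : R) :
    dualMulHom (quadEval z x) = dualMul x * dualMul x - (2 * z.re : ℂ) • dualMul x +
      (z.re ^ 2 + z.im ^ 2 : ℂ) • 1 := by
  ext f y
  change f (y * quadEval z x) = f (y * x * x) - 2 * z.re * f (y * x)
    + (z.re ^ 2 + z.im ^ 2 : ℂ) * f y
  rw [quadEval, mul_add, mul_sub, mul_smul_comm, mul_smul_comm, mul_one, map_add, map_sub,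
    map_smul, map_smul, mul_assoc]
  simp

theorem not_isUnit_quadEval_of_mem_spectrum {x : R} {z : ℂ} (hz : z ∈ spectrum ℂ (dualMul x)) :
    ¬ IsUnit (quadEval z x) := by
  intro h
  have h2 := h.map dualMulHom
  rw [dualMulHom_quadEval] at h2
  rw [spectrum.mem_iff] at hz
  exact hz (isUnit_algebraMap_sub_of_isUnit h2)

/-- Real version of the spectral radius formula. -/
theorem exists_not_isUnit_quadEval [Nontrivial R] (x : R) :
    ∃ z : ℂ, ¬ IsUnit (quadEval z x) ∧
      (∀ C s : ℝ, 0 ≤ s → (∀ k : ℕ, ‖x ^ 2 ^ k‖ ≤ C * s ^ 2 ^ k) → ‖z‖ ≤ s) ∧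
      (∀ c s : ℝ, 0 < c → 0 ≤ s → (∀ k : ℕ, c * s ^ 2 ^ k ≤ ‖x ^ 2 ^ k‖) → s ≤ ‖z‖) := by
  have : Nontrivial (R →L[ℝ] ℂ) := by
    obtain ⟨g, hg, hg1⟩ := exists_dual_vector'' ℝ (1 : R)
    refine ⟨Complex.ofRealCLM.comp g, 0, fun h => ?_⟩
    have := DFunLike.congr_fun h 1
    simp [hg1] at this
  obtain ⟨z, hz, hzr⟩ := spectrum.exists_nnnorm_eq_spectralRadius (dualMul x)
  have hlim : Tendsto (fun n : ℕ => ‖dualMul x ^ n‖ ^ (1 / n : ℝ)) atTop (𝓝 ‖z‖) := by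
    have h := spectrum.pow_norm_pow_one_div_tendsto_nhds_spectralRadius (dualMul x)
    rw [← hzr] at h
    have h' := (ENNReal.tendsto_toReal ENNReal.coe_ne_top).comp h
    refine (h'.congr fun n => ?_)
    simp only [Function.comp]
    exact ENNReal.toReal_ofReal (by positivity)
  have hpow : Tendsto (fun k : ℕ => 2 ^ k) atTop atTop :=
    tendsto_pow_atTop_atTop_of_one_lt (by norm_num : 1 < 2)
  have hlim2 := hlim.comp hpow
  have hroot : ∀ c s : ℝ, 0 < c → 0 ≤ s →
      Tendsto (fun k : ℕ => (c * s ^ 2 ^ k) ^ (1 / ((2 ^ k : ℕ) : ℝ))) atTop (𝓝 s) := by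
    intro c s hc hs
    have h1 : Tendsto (fun n : ℕ => c ^ (1 / (n : ℝ)) * s) atTop (𝓝 s) := by
      have h2 : Tendsto (fun n : ℕ => (1 / (n : ℝ))) atTop (𝓝 0) :=
        tendsto_one_div_atTop_nhds_zero_nat
      have h3 := ((Real.continuous_const_rpow hc.ne').tendsto 0).comp h2
      simpa using h3.mul_const s
    refine (h1.comp hpow).congr fun k => ?_
    simp only [Function.comp]
    rw [Real.mul_rpow hc.le (by positivity), ← Real.rpow_natCast s, ← Real.rpow_mul hs,
      mul_one_div_cancel (by positivity), Real.rpow_one]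
  have hTpow : ∀ n, dualMul x ^ n = dualMul (x ^ n) := fun n => (map_pow dualMulHom x n).symm
  have h1pos : 0 < ‖(1 : R)‖ := norm_pos_iff.mpr one_ne_zero
  refine ⟨z, not_isUnit_quadEval_of_mem_spectrum hz, fun C s hs hC => ?_,
    fun c s hc hs h => ?_⟩
  · refine le_of_tendsto_of_tendsto' hlim2 (hroot (max C 1) s (by positivity) hs) fun k => ?_
    simp only [Function.comp, hTpow]
    refine Real.rpow_le_rpow (by positivity) ?_ (by positivity)
    refine (norm_dualMul_le _).trans ((hC k).trans ?_)
    gcongr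
    exact le_max_left _ _
  · refine le_of_tendsto_of_tendsto' (hroot (c / ‖(1 : R)‖) s (by positivity) hs) hlim2 fun k => ?_
    simp only [Function.comp, hTpow]
    refine Real.rpow_le_rpow (by positivity) ?_ (by positivity)
    rw [div_mul_eq_mul_div, div_le_iff₀ h1pos]
    exact (h k).trans (norm_le_norm_dualMul _)

end Dual
section SquareNorm

variable {B : Type*} [NormedRing B]

theorem norm_pow_two_pow_le {K : ℝ} (hK : 1 ≤ K) (hsq : ∀ x : B, ‖x‖ ^ 2 ≤ K * ‖x * x‖)
    (x : B) (k : ℕ) : ‖x‖ ^ 2 ^ k ≤ K ^ 2 ^ k * ‖x ^ 2 ^ k‖ := by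
  have h : ∀ k : ℕ, K * ‖x‖ ^ 2 ^ k ≤ K ^ 2 ^ k * ‖x ^ 2 ^ k‖ := by
    intro k
    induction k with
    | zero => simp
    | succ k ih =>
      have hK0 : 0 < K := by linarith
      refine le_of_mul_le_mul_left ?_ hK0
      calc K * (K * ‖x‖ ^ 2 ^ (k + 1)) = (K * ‖x‖ ^ 2 ^ k) ^ 2 := by rw [pow_succ, pow_mul]; ring
        _ ≤ (K ^ 2 ^ k * ‖x ^ 2 ^ k‖) ^ 2 := by gcongr
        _ = (K ^ 2 ^ k) ^ 2 * ‖x ^ 2 ^ k‖ ^ 2 := by ring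
        _ ≤ (K ^ 2 ^ k) ^ 2 * (K * ‖x ^ 2 ^ k * x ^ 2 ^ k‖) := by gcongr; exact hsq _
        _ = K * (K ^ 2 ^ (k + 1) * ‖x ^ 2 ^ (k + 1)‖) := by
          rw [pow_succ 2 k, pow_mul, pow_mul, ← sq (x ^ 2 ^ k)]; ring
  exact (le_mul_of_one_le_left (by positivity) hK).trans (h k)

theorem norm_conj_le {K : ℝ} (hK : 1 ≤ K) (hsq : ∀ x : B, ‖x‖ ^ 2 ≤ K * ‖x * x‖)
    (u : Bˣ) (c : B) : ‖u * c * ↑u⁻¹‖ ≤ K * ‖c‖ := by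
  by_contra! hlt
  have hK0 : 0 < K := by linarith
  rcases eq_or_ne c 0 with rfl | hc
  · simp at hlt
  have hc' : 0 < ‖c‖ := norm_pos_iff.mpr hc
  have hb : 1 < ‖u * c * ↑u⁻¹‖ / (K * ‖c‖) := by rwa [one_lt_div (by positivity)]
  obtain ⟨n, hn⟩ := pow_unbounded_of_one_lt (‖(u : B)‖ * ‖(↑u⁻¹ : B)‖) hb
  have hmono := pow_le_pow_right₀ hb.le (Nat.lt_two_pow_self (n := n)).le
  have h1 := norm_pow_two_pow_le hK hsq (u * c * ↑u⁻¹) n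
  rw [Units.conj_pow] at h1
  have h2 : ‖(u : B) * c ^ 2 ^ n * ↑u⁻¹‖ ≤ ‖(u : B)‖ * ‖c‖ ^ 2 ^ n * ‖(↑u⁻¹ : B)‖ := by
    refine (norm_mul_le _ _).trans ?_
    gcongr
    refine (norm_mul_le _ _).trans ?_
    gcongr
    exact norm_pow_le' _ (by positivity)
  have h3 : (‖u * c * ↑u⁻¹‖ / (K * ‖c‖)) ^ 2 ^ n ≤ ‖(u : B)‖ * ‖(↑u⁻¹ : B)‖ := by
    rw [div_pow, div_le_iff₀ (by positivity), mul_pow]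
    refine h1.trans ((mul_le_mul_of_nonneg_left h2 (by positivity)).trans_eq (by ring))
  linarith

theorem isUnit_of_mul_eq_one_of_norm_sq_le {K : ℝ} (hsq : ∀ x : B, ‖x‖ ^ 2 ≤ K * ‖x * x‖)
    {x y : B} (h : y * x = 1) : IsUnit x := by
  have h0 : x * (1 - x * y) = 0 := by
    have h1 : (x * (1 - x * y)) * (x * (1 - x * y)) = 0 := by
      have : (1 - x * y) * x = 0 := by rw [sub_mul, mul_assoc, h]; simp
      rw [mul_assoc, ← mul_assoc (1 - x * y), this]; simp
    have h2 := hsq (x * (1 - x * y))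
    rw [h1, norm_zero, mul_zero] at h2
    exact norm_eq_zero.mp (pow_eq_zero_iff two_ne_zero |>.mp (le_antisymm h2 (by positivity)))
  have h3 : 1 - x * y = 0 := by
    rw [← one_mul (1 - x * y), ← h, mul_assoc]
    rw [h]
    rw [h0, mul_zero]
  exact ⟨⟨x, y, (sub_eq_zero.mp h3).symm, h⟩, rfl⟩

theorem exists_mul_sub_one_mem {R : Type*} [Ring R] {M : Ideal R} (hM : M.IsMaximal) {x : R}
    (hx : x ∉ M) : ∃ y, y * x - 1 ∈ M := by
  have h : Ideal.span {x} ⊔ M = ⊤ := by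
    refine hM.out.2 _ (lt_of_le_of_ne le_sup_right fun h => hx ?_)
    rw [h]
    exact Ideal.mem_sup_left (Ideal.mem_span_singleton_self x)
  have h1 : (1 : R) ∈ Ideal.span {x} ⊔ M := h ▸ Submodule.mem_top
  obtain ⟨a, b, hb, hab⟩ := Ideal.mem_span_singleton_sup.mp h1
  exact ⟨a, by rw [← hab, sub_add_cancel_left]; exact M.neg_mem hb⟩

theorem isTwoSided_of_isMaximal [NormedAlgebra ℝ B] [CompleteSpace B] {K : ℝ} (hK : 1 ≤ K)
    (hsq : ∀ x : B, ‖x‖ ^ 2 ≤ K * ‖x * x‖) {M : Ideal B} (hM : M.IsMaximal) : M.IsTwoSided := by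
  refine ⟨fun {m} c hm => ?_⟩
  by_contra hmc
  obtain ⟨d, hd⟩ := exists_mul_sub_one_mem hM hmc
  set n := d * m with hn
  have hnM : n ∈ M := M.mul_mem_left d hm
  have hnc : n * c - 1 ∈ M := by rwa [hn, mul_assoc]
  obtain ⟨t, ht, htn⟩ : ∃ t : ℝ, 0 < t ∧ ‖t • n‖ < 1 := by
    refine ⟨(‖n‖ + 1)⁻¹, by positivity, ?_⟩
    rw [norm_smul, norm_inv, Real.norm_of_nonneg (by positivity), inv_mul_lt_iff₀ (by positivity)]
    linarith
  have hsmul : ∀ (r : ℝ) {y : B}, y ∈ M → r • y ∈ M := fun r y hy => by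
    rw [← one_mul y, ← smul_mul_assoc]; exact M.mul_mem_left _ hy
  let u : Bˣ := Units.oneSub (-(t • n)) (by rwa [norm_neg])
  have hu : (u : B) = 1 + t • n := by simp [u]
  have hinv : (↑u⁻¹ : B) - 1 ∈ M := by
    have : (↑u⁻¹ : B) - 1 = -(↑u⁻¹ * (t • n)) := by
      have h1 : (↑u⁻¹ : B) * (1 + t • n) = 1 := by rw [← hu]; exact u.inv_mul
      rw [mul_add, mul_one] at h1
      rw [← h1]; abel
    rw [this]
    exact M.neg_mem (M.mul_mem_left _ (hsmul t hnM))
  have hinvk : ∀ k : ℕ, (↑(u ^ k)⁻¹ : B) - 1 ∈ M := by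
    intro k
    induction k with
    | zero => simp
    | succ k ih =>
      have : (↑(u ^ (k + 1))⁻¹ : B) - 1
          = ↑u⁻¹ * ((↑(u ^ k)⁻¹ : B) - 1) + ((↑u⁻¹ : B) - 1) := by
        rw [pow_succ, mul_inv_rev, Units.val_mul]; noncomm_ring
      rw [this]
      exact M.add_mem (M.mul_mem_left _ ih) hinv
  have huk : ∀ k : ℕ, (↑(u ^ k) : B) * c - (c + (k * t) • (1 : B)) ∈ M := by
    intro k
    induction k with
    | zero => simp
    | succ k ih =>
      have : (↑(u ^ (k + 1)) : B) * c - (c + ((k + 1 : ℕ) * t) • (1 : B))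
          = (u : B) * ((↑(u ^ k) : B) * c - (c + (k * t) • (1 : B)))
            + (t • (n * c - 1) + (k * t * t) • n) := by
        rw [pow_succ', Units.val_mul, mul_sub, mul_assoc, hu]
        simp only [add_mul, mul_add, one_mul, mul_one, smul_mul_assoc, mul_smul_comm]
        push_cast
        module
      rw [this]
      exact M.add_mem (M.mul_mem_left _ ih) (M.add_mem (hsmul _ hnc) (hsmul _ hnM))
  obtain ⟨k, hk⟩ := exists_nat_gt ((K * ‖c‖ + ‖c‖) / t)
  rw [div_lt_iff₀ ht] at hk
  have hpos : 0 < k * t := lt_of_le_of_lt (by positivity) hk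
  set w := (↑(u ^ k) : B) * c * ↑(u ^ k)⁻¹ with hw
  have hwM : w - (c + (k * t) • (1 : B)) ∈ M := by
    have : w - (c + (k * t) • (1 : B)) = (↑(u ^ k) * c) * ((↑(u ^ k)⁻¹ : B) - 1)
        + (↑(u ^ k) * c - (c + (k * t) • (1 : B))) := by rw [hw, mul_sub, mul_one]; abel
    rw [this]
    exact M.add_mem (M.mul_mem_left _ (hinvk k)) (huk k)
  refine hM.ne_top (M.eq_top_of_norm_lt_one (hsmul (-(k * t)⁻¹) hwM) ?_)
  have : 1 - -(k * t)⁻¹ • (w - (c + (k * t) • (1 : B))) = (k * t)⁻¹ • (w - c) := by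
    have h1 : (k * t)⁻¹ • ((k * t) • (1 : B)) = 1 := by
      rw [smul_smul, inv_mul_cancel₀ hpos.ne', one_smul]
    rw [neg_smul, smul_sub, smul_add, h1, smul_sub]; abel
  rw [this, norm_smul, norm_inv, Real.norm_of_nonneg hpos.le, inv_mul_lt_iff₀ hpos, mul_one]
  exact ((norm_sub_le _ _).trans (by gcongr; exact norm_conj_le hK hsq _ _)).trans_lt hk

end SquareNorm

section Quotient

variable {B : Type*} [NormedRing B]

/-- The quotient norm on the quotient of a normed ring by a closed two-sided ideal. -/
noncomputable abbrev quotientNormedRing (M : Ideal B) [M.IsTwoSided] [IsClosed (M : Set B)] :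
    NormedRing (B ⧸ M) where
  __ := Submodule.Quotient.normedAddCommGroup M
  __ := Ideal.Quotient.ring M
  norm_mul_le x y := by
    have key : ∀ ε > 0, ‖x * y‖ ≤ (‖x‖ + ε) * (‖y‖ + ε) := by
      intro ε hε
      obtain ⟨a, rfl, ha⟩ := Submodule.Quotient.norm_mk_lt x hε
      obtain ⟨b, rfl, hb⟩ := Submodule.Quotient.norm_mk_lt y hε
      exact (Submodule.Quotient.norm_mk_le M (a * b)).trans ((norm_mul_le a b).trans (by gcongr))
    have hlim : Tendsto (fun ε : ℝ => (‖x‖ + ε) * (‖y‖ + ε)) (𝓝[>] 0) (𝓝 (‖x‖ * ‖y‖)) := by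
      have : Continuous (fun ε : ℝ => (‖x‖ + ε) * (‖y‖ + ε)) := by fun_prop
      simpa using (this.tendsto 0).mono_left nhdsWithin_le_nhds
    exact ge_of_tendsto hlim (eventually_nhdsWithin_of_forall key)

theorem exists_quadEval_eq_zero_of_isMaximal [NormedAlgebra ℝ B] [CompleteSpace B] {M : Ideal B}
    [hM : M.IsMaximal] [M.IsTwoSided] (hinv : ∀ y : B ⧸ M, y ≠ 0 → IsUnit y) (x : B) :
    ∃ z : ℂ, quadEval z (Ideal.Quotient.mk M x) = 0 ∧
      ∀ C s : ℝ, 0 ≤ s → (∀ k : ℕ, ‖x ^ 2 ^ k‖ ≤ C * s ^ 2 ^ k) → ‖z‖ ≤ s := by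
  let _ := quotientNormedRing M
  let _ : NormedAlgebra ℝ (B ⧸ M) :=
    { Ideal.Quotient.algebra ℝ with
      norm_smul_le := (Submodule.Quotient.normedSpace M ℝ).norm_smul_le }
  have : Nontrivial (B ⧸ M) := Submodule.Quotient.nontrivial_iff.mpr hM.ne_top
  obtain ⟨z, hz, hup, -⟩ := exists_not_isUnit_quadEval (Ideal.Quotient.mk M x)
  refine ⟨z, by_contra fun h => hz (hinv _ h), fun C s hs hC => hup C s hs fun k => ?_⟩
  rw [← map_pow]
  exact (Submodule.Quotient.norm_mk_le M _).trans (hC k)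

theorem isUnit_quotient_of_isMaximal {R : Type*} [Ring R] {M : Ideal R} [hM : M.IsMaximal]
    [M.IsTwoSided] {x : R ⧸ M} (hx : x ≠ 0) : IsUnit x := by
  have hleft : ∀ x : R ⧸ M, x ≠ 0 → ∃ y, y * x = 1 := by
    intro x hx
    obtain ⟨x, rfl⟩ := Ideal.Quotient.mk_surjective x
    obtain ⟨y, hy⟩ := exists_mul_sub_one_mem hM (mt Ideal.Quotient.eq_zero_iff_mem.mpr hx)
    exact ⟨Ideal.Quotient.mk M y, by
      rw [← map_mul, ← map_one (Ideal.Quotient.mk M)]; exact Ideal.Quotient.eq.mpr hy⟩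
  obtain ⟨y, hy⟩ := hleft x hx
  have hy0 : y ≠ 0 := by
    rintro rfl
    rw [zero_mul] at hy
    exact hx (by rw [← one_mul x, ← hy, zero_mul])
  obtain ⟨w, hw⟩ := hleft y hy0
  exact ⟨⟨x, y, by rwa [← left_inv_eq_right_inv hw hy], hy⟩, rfl⟩

/-- Growth rates of powers are submultiplicative in a real Banach algebra whose norm satisfies
`‖x‖² ≤ K ‖x²‖`. -/
theorem growth_le_mul_of_norm_sq_le [NormedAlgebra ℝ B] [CompleteSpace B] [Nontrivial B] {K : ℝ}
    (hK : 1 ≤ K) (hsq : ∀ x : B, ‖x‖ ^ 2 ≤ K * ‖x * x‖) {a b : B} {C s t r : ℝ} (hC : 0 < C)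
    (hs : 0 ≤ s) (ht : 0 ≤ t) (hr : 0 ≤ r) (ha : ∀ k : ℕ, ‖a ^ 2 ^ k‖ ≤ C * s ^ 2 ^ k)
    (hb : ∀ k : ℕ, ‖b ^ 2 ^ k‖ ≤ C * t ^ 2 ^ k)
    (hab : ∀ k : ℕ, C * r ^ 2 ^ k ≤ ‖(a * b) ^ 2 ^ k‖) : r ≤ s * t := by
  obtain ⟨z, hz, -, hlow⟩ := exists_not_isUnit_quadEval (a * b)
  have hspan : Ideal.span {quadEval z (a * b)} ≠ ⊤ := by
    intro h
    obtain ⟨y, hy⟩ := Ideal.mem_span_singleton'.mp ((Ideal.eq_top_iff_one _).mp h)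
    exact hz (isUnit_of_mul_eq_one_of_norm_sq_le hsq hy)
  obtain ⟨M, hM, hle⟩ := Ideal.exists_le_maximal _ hspan
  have := isTwoSided_of_isMaximal hK hsq hM
  have hnt : Nontrivial (B ⧸ M) := Submodule.Quotient.nontrivial_iff.mpr hM.ne_top
  have hinv : ∀ y : B ⧸ M, y ≠ 0 → IsUnit y := fun y hy => isUnit_quotient_of_isMaximal hy
  have : NoZeroDivisors (B ⧸ M) :=
    ⟨fun {x y} hxy => or_iff_not_imp_left.mpr fun hx => ((hinv x hx).mul_right_eq_zero).mp hxy⟩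
  have hquad : ∀ x : B ⧸ M, ∃ z : ℂ, quadEval z x = 0 := by
    intro x
    obtain ⟨x, rfl⟩ := Ideal.Quotient.mk_surjective x
    obtain ⟨z, hz, -⟩ := exists_quadEval_eq_zero_of_isMaximal hinv x
    exact ⟨z, hz⟩
  obtain ⟨za, hza, hsa⟩ := exists_quadEval_eq_zero_of_isMaximal hinv a
  obtain ⟨zb, hzb, hsb⟩ := exists_quadEval_eq_zero_of_isMaximal hinv b
  have hzab : quadEval z (Ideal.Quotient.mk M a * Ideal.Quotient.mk M b) = 0 :=
    Ideal.Quotient.eq_zero_iff_mem.mpr (hle (Ideal.mem_span_singleton_self _))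
  have hnorm := norm_sq_mul_of_quadEval hquad hza hzb hzab
  have hnsq : ∀ w : ℂ, w.re ^ 2 + w.im ^ 2 = ‖w‖ ^ 2 := fun w => by
    rw [← Complex.normSq_eq_norm_sq, Complex.normSq_apply]; ring
  rw [hnsq, hnsq, hnsq, ← mul_pow] at hnorm
  have hz' : ‖z‖ = ‖za‖ * ‖zb‖ := (sq_eq_sq₀ (by positivity) (by positivity)).mp hnorm
  calc r ≤ ‖z‖ := hlow C r hC hr hab
    _ = ‖za‖ * ‖zb‖ := hz'
    _ ≤ s * t := mul_le_mul (hsa C s hs ha) (hsb C t ht hb) (norm_nonneg _) hs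

end Quotient

section SquareSeminorm

variable {A : Type*} [NonUnitalRing A] [Module ℝ A] {p : A → ℝ}

theorem map_zero_of_homog (hhomog : ∀ (k : ℝ) (a : A), p (k • a) = |k| * p a) : p 0 = 0 := by
  simpa using hhomog 0 0

theorem map_neg_of_homog (hhomog : ∀ (k : ℝ) (a : A), p (k • a) = |k| * p a) (a : A) :
    p (-a) = p a := by
  simpa using hhomog (-1) a

theorem map_sub_le_of_triangle (htriangle : ∀ a b, p (a + b) ≤ p a + p b)
    (hhomog : ∀ (k : ℝ) (a : A), p (k • a) = |k| * p a) (a b : A) : p (a - b) ≤ p a + p b := by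
  simpa [sub_eq_add_neg, map_neg_of_homog hhomog] using htriangle a (-b)

theorem map_anticommutator_le (hnonneg : ∀ a, 0 ≤ p a) (htriangle : ∀ a b, p (a + b) ≤ p a + p b)
    (hhomog : ∀ (k : ℝ) (a : A), p (k • a) = |k| * p a) (hsq : ∀ a, p (a * a) = (p a) ^ 2)
    {a b : A} (ha : p a ≤ 1) (hb : p b ≤ 1) : p (a * b + b * a) ≤ 4 := by
  have h1 := map_sub_le_of_triangle htriangle hhomog ((a + b) * (a + b)) ((a - b) * (a - b))
  rw [show (a + b) * (a + b) - (a - b) * (a - b) = (2 : ℝ) • (a * b + b * a) by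
    simp only [mul_add, add_mul, mul_sub, sub_mul]; module, hhomog, hsq, hsq, abs_two] at h1
  have h2 : p (a + b) ≤ 2 := (htriangle a b).trans (by linarith)
  have h3 : p (a - b) ≤ 2 := (map_sub_le_of_triangle htriangle hhomog a b).trans (by linarith)
  nlinarith [hnonneg (a + b), hnonneg (a - b)]

variable [SMulCommClass ℝ A A] [IsScalarTower ℝ A A]

theorem map_mul_mul_self_le (hnonneg : ∀ a, 0 ≤ p a) (htriangle : ∀ a b, p (a + b) ≤ p a + p b)
    (hhomog : ∀ (k : ℝ) (a : A), p (k • a) = |k| * p a) (hsq : ∀ a, p (a * a) = (p a) ^ 2)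
    {a b : A} (ha : p a ≤ 1) (hb : p b ≤ 1) : p (a * b * a) ≤ 10 := by
  have hab := map_anticommutator_le hnonneg htriangle hhomog hsq ha hb
  have haa : p (a * a) ≤ 1 := by rw [hsq]; nlinarith [hnonneg a]
  have h1 : p ((1 / 4 : ℝ) • (a * b + b * a)) ≤ 1 := by
    rw [hhomog, abs_of_pos (by norm_num)]; linarith
  have h2 := map_anticommutator_le hnonneg htriangle hhomog hsq ha h1
  have h3 := map_anticommutator_le hnonneg htriangle hhomog hsq haa hb
  have h4 : (2 : ℝ) • (a * b * a) = (4 : ℝ) • (a * ((1 / 4 : ℝ) • (a * b + b * a))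
      + ((1 / 4 : ℝ) • (a * b + b * a)) * a) - (a * a * b + b * (a * a)) := by
    simp only [mul_smul_comm, smul_mul_assoc, mul_add, add_mul, mul_assoc]
    module
  have h5 := map_sub_le_of_triangle htriangle hhomog ((4 : ℝ) • (a * ((1 / 4 : ℝ) •
    (a * b + b * a)) + ((1 / 4 : ℝ) • (a * b + b * a)) * a)) (a * a * b + b * (a * a))
  rw [← h4, hhomog, hhomog, abs_two, abs_of_pos (by norm_num : (0 : ℝ) < 4)] at h5
  linarith

theorem map_mul_le_six_of_le_one (hnonneg : ∀ a, 0 ≤ p a)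
    (htriangle : ∀ a b, p (a + b) ≤ p a + p b)
    (hhomog : ∀ (k : ℝ) (a : A), p (k • a) = |k| * p a) (hsq : ∀ a, p (a * a) = (p a) ^ 2)
    {a b : A} (ha : p a ≤ 1) (hb : p b ≤ 1) : p (a * b) ≤ 6 := by
  have hab := map_anticommutator_le hnonneg htriangle hhomog hsq ha hb
  have haa : p (a * a) ≤ 1 := by rw [hsq]; nlinarith [hnonneg a]
  have hbb : p (b * b) ≤ 1 := by rw [hsq]; nlinarith [hnonneg b]
  have h1 := map_mul_mul_self_le hnonneg htriangle hhomog hsq ha hbb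
  have h2 := map_mul_mul_self_le hnonneg htriangle hhomog hsq hb haa
  have h3 : (a * b - b * a) * (a * b - b * a) = (a * b + b * a) * (a * b + b * a)
      - (2 : ℝ) • (a * (b * b) * a + b * (a * a) * b) := by
    simp only [mul_add, add_mul, mul_sub, sub_mul, mul_assoc]
    module
  have h4 := map_sub_le_of_triangle htriangle hhomog ((a * b + b * a) * (a * b + b * a))
    ((2 : ℝ) • (a * (b * b) * a + b * (a * a) * b))
  rw [← h3, hsq, hsq, hhomog, abs_two] at h4
  have h5 := htriangle (a * (b * b) * a) (b * (a * a) * b)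
  have h6 : p (a * b - b * a) ≤ 8 := by nlinarith [hnonneg (a * b - b * a), hnonneg (a * b + b * a)]
  have h7 := htriangle (a * b + b * a) (a * b - b * a)
  rw [show a * b + b * a + (a * b - b * a) = (2 : ℝ) • (a * b) by module, hhomog, abs_two] at h7
  linarith

theorem map_mul_le_six_mul (hnonneg : ∀ a, 0 ≤ p a) (htriangle : ∀ a b, p (a + b) ≤ p a + p b)
    (hhomog : ∀ (k : ℝ) (a : A), p (k • a) = |k| * p a) (hsq : ∀ a, p (a * a) = (p a) ^ 2)
    (a b : A) : p (a * b) ≤ 6 * (p a * p b) := by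
  have key : ∀ ε > 0, p (a * b) ≤ 6 * ((p a + ε) * (p b + ε)) := by
    intro ε hε
    have ha : 0 < p a + ε := add_pos_of_nonneg_of_pos (hnonneg a) hε
    have hb : 0 < p b + ε := add_pos_of_nonneg_of_pos (hnonneg b) hε
    have h1 : p ((p a + ε)⁻¹ • a) ≤ 1 := by
      rw [hhomog, abs_of_pos (by positivity), inv_mul_le_one₀ ha]; linarith
    have h2 : p ((p b + ε)⁻¹ • b) ≤ 1 := by
      rw [hhomog, abs_of_pos (by positivity), inv_mul_le_one₀ hb]; linarith
    have h3 := map_mul_le_six_of_le_one hnonneg htriangle hhomog hsq h1 h2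
    rw [smul_mul_smul_comm, hhomog, ← mul_inv, abs_of_pos (by positivity),
      inv_mul_le_iff₀ (by positivity)] at h3
    linarith
  have hlim : Tendsto (fun ε : ℝ => 6 * ((p a + ε) * (p b + ε))) (𝓝[>] 0)
      (𝓝 (6 * (p a * p b))) := by
    have : Continuous (fun ε : ℝ => 6 * ((p a + ε) * (p b + ε))) := by fun_prop
    simpa using (this.tendsto 0).mono_left nhdsWithin_le_nhds
  exact ge_of_tendsto hlim (eventually_nhdsWithin_of_forall key)

/-- The `ℓ¹`-type seminorm on the unitization of an algebra with a seminorm satisfying the square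
property. -/
def unitizationSeminorm (hnonneg : ∀ a, 0 ≤ p a) (htriangle : ∀ a b, p (a + b) ≤ p a + p b)
    (hhomog : ∀ (k : ℝ) (a : A), p (k • a) = |k| * p a) (hsq : ∀ a, p (a * a) = (p a) ^ 2) :
    RingSeminorm (Unitization ℝ A) where
  toFun x := |x.fst| + 6 * p x.snd
  map_zero' := by simp [map_zero_of_homog hhomog]
  add_le' x y := by
    simp only [Unitization.fst_add, Unitization.snd_add]
    linarith [abs_add_le x.fst y.fst, htriangle x.snd y.snd]
  neg' x := by simp [map_neg_of_homog hhomog]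
  mul_le' x y := by
    simp only [Unitization.fst_mul, Unitization.snd_mul, abs_mul]
    have h1 := htriangle (x.fst • y.snd + y.fst • x.snd) (x.snd * y.snd)
    have h2 := htriangle (x.fst • y.snd) (y.fst • x.snd)
    rw [hhomog, hhomog] at h2
    linarith [map_mul_le_six_mul hnonneg htriangle hhomog hsq x.snd y.snd]

theorem unitizationSeminorm_sq_le (hnonneg : ∀ a, 0 ≤ p a)
    (htriangle : ∀ a b, p (a + b) ≤ p a + p b)
    (hhomog : ∀ (k : ℝ) (a : A), p (k • a) = |k| * p a) (hsq : ∀ a, p (a * a) = (p a) ^ 2)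
    (x : Unitization ℝ A) :
    unitizationSeminorm hnonneg htriangle hhomog hsq x ^ 2 ≤
      625 * unitizationSeminorm hnonneg htriangle hhomog hsq (x * x) := by
  change (|x.fst| + 6 * p x.snd) ^ 2 ≤ 625 * (|(x * x).fst| + 6 * p (x * x).snd)
  simp only [Unitization.fst_mul, Unitization.snd_mul, abs_mul]
  have h1 := map_sub_le_of_triangle htriangle hhomog
    (x.fst • x.snd + x.fst • x.snd + x.snd * x.snd) ((2 * x.fst) • x.snd)
  rw [show x.fst • x.snd + x.fst • x.snd + x.snd * x.snd - (2 * x.fst) • x.snd = x.snd * x.snd by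
    module, hsq, hhomog, abs_mul, abs_two] at h1
  have h2 := hnonneg (x.fst • x.snd + x.fst • x.snd + x.snd * x.snd)
  have h3 := hnonneg x.snd
  have h4 := abs_nonneg x.fst
  rcases le_total (4 * |x.fst|) (p x.snd) with h | h
  · nlinarith
  · nlinarith

theorem exists_inr_pow_two_pow (hsq : ∀ a, p (a * a) = (p a) ^ 2) (a : A) (k : ℕ) :
    ∃ b : A, (a : Unitization ℝ A) ^ 2 ^ k = b ∧ p b = p a ^ 2 ^ k := by
  induction k with
  | zero => exact ⟨a, by simp⟩
  | succ k ih =>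
    obtain ⟨b, hb, hpb⟩ := ih
    refine ⟨b * b, ?_, ?_⟩
    · rw [pow_succ 2 k, pow_mul, hb, sq, Unitization.inr_mul]
    · rw [hsq, hpb, pow_succ 2 k, pow_mul]

end SquareSeminorm

/-- A seminorm with square property on a real associative algebra is
submultiplicative. -/
theorem seminorm_square_property_submultiplicative
    {A : Type*} [NonUnitalRing A] [Module ℝ A]
    [SMulCommClass ℝ A A] [IsScalarTower ℝ A A]
    (p : A → ℝ)
    (hnonneg : ∀ a, 0 ≤ p a)
    (htriangle : ∀ a b, p (a + b) ≤ p a + p b)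
    (hhomog : ∀ (k : ℝ) (a : A), p (k • a) = |k| * p a)
    (hsq : ∀ a, p (a * a) = (p a) ^ 2) :
    ∀ a b, p (a * b) ≤ p a * p b := by
  intro a b
  let _ : SeminormedRing (Unitization ℝ A) :=
    (unitizationSeminorm hnonneg htriangle hhomog hsq).toSeminormedRing
  have hnorm : ∀ x : Unitization ℝ A, ‖x‖ = |x.fst| + 6 * p x.snd := fun _ => rfl
  let _ : NormedAlgebra ℝ (Unitization ℝ A) :=
    { (inferInstance : Algebra ℝ (Unitization ℝ A)) with
      norm_smul_le := fun r x => by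
        rw [hnorm, hnorm, Unitization.fst_smul, Unitization.snd_smul, hhomog, smul_eq_mul, abs_mul,
          Real.norm_eq_abs]
        exact le_of_eq (by ring) }
  let B := UniformSpace.Completion (Unitization ℝ A)
  let _ : NormedAlgebra ℝ B :=
    { UniformSpace.Completion.algebra (Unitization ℝ A) ℝ with
      norm_smul_le := fun r x => norm_smul_le r x }
  have hone : ‖(1 : B)‖ = 1 := by
    rw [← UniformSpace.Completion.coe_one, UniformSpace.Completion.norm_coe, hnorm]
    simp [map_zero_of_homog hhomog]
  have : Nontrivial B := ⟨1, 0, fun h => by rw [h, norm_zero] at hone; exact zero_ne_one hone⟩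
  have hB : ∀ x : B, ‖x‖ ^ 2 ≤ 625 * ‖x * x‖ := by
    intro x
    induction x using UniformSpace.Completion.induction_on with
    | hp => apply isClosed_le <;> fun_prop
    | ih x =>
      rw [← UniformSpace.Completion.coe_mul, UniformSpace.Completion.norm_coe,
        UniformSpace.Completion.norm_coe]
      exact unitizationSeminorm_sq_le hnonneg htriangle hhomog hsq x
  have hpow : ∀ (c : A) (k : ℕ),
      ‖(UniformSpace.Completion.coeRingHom (c : Unitization ℝ A) : B) ^ 2 ^ k‖
        = 6 * p c ^ 2 ^ k := by
    intro c k
    obtain ⟨d, hd, hpd⟩ := exists_inr_pow_two_pow hsq c k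
    rw [← map_pow, hd, ← hpd]
    refine (UniformSpace.Completion.norm_coe _).trans ?_
    simp [hnorm]
  refine growth_le_mul_of_norm_sq_le (by norm_num) hB (C := 6) (by norm_num) (hnonneg a)
    (hnonneg b) (hnonneg (a * b)) (fun k => (hpow a k).le) (fun k => (hpow b k).le) fun k => ?_
  rw [← map_mul, ← Unitization.inr_mul]
  exact (hpow (a * b) k).ge
end

section
/- Let A be a real unital Banach algebra (complete submultiplicative norm, with unit) and suppose there is a constant m > 0 such that ‖a‖ ≤ m·r(a) for all a ∈ A, where r(a) = lim_{n→∞} ‖aⁿ‖^{1/n}. Then an element a ∈ A is invertible in A if and only if x(a) ≠ 0 for every nonzero (equivalently, unital) ℝ-algebra homomorphism x : A → ℍ into the real quaternion algebra ℍ. -/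
open Filter Quaternion

section Frobenius

variable {D : Type*} [Ring D] [Algebra ℝ D]

/-- The parts of `x` commuting and anticommuting with a square root `i` of `-1`. -/
theorem exists_add_eq_commute_anticommute {i : D} (hi : i * i = -1) (x : D) :
    ∃ y z : D, x = y + z ∧ Commute y i ∧ i * z = -(z * i) := by
  have h1 : i * (i * x * i) = -(x * i) := by
    rw [← mul_assoc, ← mul_assoc, hi, neg_one_mul, neg_mul]
  have h2 : i * x * i * i = -(i * x) := by
    rw [mul_assoc, hi, mul_neg_one]
  refine ⟨(2⁻¹ : ℝ) • (x - i * x * i), (2⁻¹ : ℝ) • (x + i * x * i), by module, ?_, ?_⟩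
  · rw [commute_iff_eq]
    simp only [smul_mul_assoc, mul_smul_comm, sub_mul, mul_sub, h1, h2]
    module
  · simp only [smul_mul_assoc, mul_smul_comm, add_mul, mul_add, h1, h2]
    module

variable [NoZeroDivisors D]

/-- In an algebra where every element is a root of a real quadratic polynomial without two distinct
real roots, every element is a real combination of `1` and a square root of `-1`. -/
theorem exists_eq_algebraMap_or_exists_mul_self_eq_neg_one
    (hD : ∀ x : D, ∃ s t : ℝ, x * x - (2 * s) • x + (s ^ 2 + t ^ 2) • (1 : D) = 0) (x : D) :
    (∃ s : ℝ, x = s • (1 : D)) ∨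
      ∃ s t : ℝ, ∃ u : D, t ≠ 0 ∧ u * u = -1 ∧ x = s • (1 : D) + t • u := by
  obtain ⟨s, t, h⟩ := hD x
  have hsq : (x - s • (1 : D)) * (x - s • (1 : D)) = -(t ^ 2) • (1 : D) := by
    simp only [sub_mul, mul_sub, smul_mul_assoc, mul_smul_comm, one_mul, mul_one]
    linear_combination (norm := module) h
  by_cases ht : t = 0
  · left
    refine ⟨s, sub_eq_zero.mp (mul_self_eq_zero.mp ?_)⟩
    simpa [ht] using hsq
  · right
    refine ⟨s, t, t⁻¹ • (x - s • (1 : D)), ht, ?_, ?_⟩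
    · rw [smul_mul_smul_comm, hsq, smul_smul]
      have : t⁻¹ * t⁻¹ * -t ^ 2 = -1 := by field_simp
      rw [this, neg_one_smul]
    · rw [smul_inv_smul₀ ht]
      abel

theorem exists_eq_of_commute
    (hD : ∀ x : D, ∃ s t : ℝ, x * x - (2 * s) • x + (s ^ 2 + t ^ 2) • (1 : D) = 0)
    {i x : D} (hi : i * i = -1) (hx : Commute x i) :
    ∃ s t : ℝ, x = s • (1 : D) + t • i := by
  rcases exists_eq_algebraMap_or_exists_mul_self_eq_neg_one hD x with
    ⟨s, hs⟩ | ⟨s, t, u, ht, hu, rfl⟩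
  · exact ⟨s, 0, by simpa using hs⟩
  · have hui : Commute u i := by
      have h : Commute (t • u) i := by
        simpa using hx.sub_left ((Commute.one_left i).smul_left s)
      simpa [smul_smul, ht] using h.smul_left t⁻¹
    rcases hui.mul_self_eq_mul_self_iff.mp (hu.trans hi.symm) with rfl | rfl
    · exact ⟨s, t, rfl⟩
    · exact ⟨s, -t, by simp⟩

theorem exists_mul_self_eq_neg_one_anticommute
    (hD : ∀ x : D, ∃ s t : ℝ, x * x - (2 * s) • x + (s ^ 2 + t ^ 2) • (1 : D) = 0)
    {i z : D} (hi : i * i = -1) (hz : z ≠ 0) (hiz : i * z = -(z * i)) :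
    ∃ j : D, j * j = -1 ∧ i * j = -(j * i) := by
  have : Nontrivial D := ⟨z, 0, hz⟩
  have hi0 : i ≠ 0 := by rintro rfl; simp at hi
  have hscalar : ∀ s : ℝ, Commute (s • z) i → s = 0 := by
    intro s hs
    have h : (2 * s) • (z * i) = 0 := by
      have h := hs.eq
      rw [smul_mul_assoc, mul_smul_comm, hiz] at h
      linear_combination (norm := module) h
    have := (smul_eq_zero.mp h).resolve_right (mul_ne_zero hz hi0)
    linarith
  rcases exists_eq_algebraMap_or_exists_mul_self_eq_neg_one hD z with
    ⟨s, hs⟩ | ⟨s, t, u, ht, hu, hzu⟩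
  · exfalso
    have h1 : Commute ((1 : ℝ) • z) i := by
      rw [one_smul, hs]
      exact (Commute.one_left i).smul_left s
    exact one_ne_zero (hscalar 1 h1)
  · have hzz : Commute (z * z) i := by
      rw [commute_iff_eq, ← mul_assoc i, hiz, neg_mul, mul_assoc z i, hiz]
      simp [mul_assoc]
    have hs : s = 0 := by
      have h2 : (2 * s) • z = z * z + (s ^ 2 + t ^ 2) • (1 : D) := by
        rw [hzu]
        simp only [add_mul, mul_add, smul_mul_assoc, mul_smul_comm, one_mul, mul_one, hu]
        module
      have h3 := hscalar (2 * s) (by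
        rw [h2]
        exact hzz.add_left ((Commute.one_left i).smul_left _))
      linarith
    refine ⟨u, hu, ?_⟩
    rw [hs, zero_smul, zero_add] at hzu
    rw [hzu, mul_smul_comm, smul_mul_assoc, ← smul_neg] at hiz
    exact smul_right_injective D ht hiz

/-- A weak form of the Frobenius theorem on real division algebras. -/
theorem nonempty_algHom_quaternion [Nontrivial D]
    (hD : ∀ x : D, ∃ s t : ℝ, x * x - (2 * s) • x + (s ^ 2 + t ^ 2) • (1 : D) = 0) :
    Nonempty (D →ₐ[ℝ] ℍ[ℝ]) := by
  by_cases hscalar : ∀ x : D, ∃ s : ℝ, x = s • (1 : D)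
  · have hbij : Function.Bijective (Algebra.ofId ℝ D) :=
      ⟨(Algebra.ofId ℝ D).toRingHom.injective, fun x ↦ by
        obtain ⟨s, rfl⟩ := hscalar x
        exact ⟨s, Algebra.algebraMap_eq_smul_one s⟩⟩
    exact ⟨(Algebra.ofId ℝ ℍ[ℝ]).comp (AlgEquiv.ofBijective _ hbij).symm.toAlgHom⟩
  obtain ⟨i, hi⟩ : ∃ i : D, i * i = -1 := by
    push Not at hscalar
    obtain ⟨x, hx⟩ := hscalar
    rcases exists_eq_algebraMap_or_exists_mul_self_eq_neg_one hD x with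
      ⟨s, hs⟩ | ⟨s, t, u, ht, hu, hxu⟩
    · exact absurd hs (hx s)
    · exact ⟨u, hu⟩
  by_cases hanti : ∃ z : D, z ≠ 0 ∧ i * z = -(z * i)
  · obtain ⟨z, hz, hiz⟩ := hanti
    obtain ⟨j, hj, hij⟩ := exists_mul_self_eq_neg_one_anticommute hD hi hz hiz
    let q : QuaternionAlgebra.Basis D (-1 : ℝ) 0 (-1) :=
      { i := i
        j := j
        k := i * j
        i_mul_i := by simp [hi]
        j_mul_j := by simp [hj]
        i_mul_j := rfl
        j_mul_i := by simp [hij] }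
    let f : ℍ[ℝ] →ₐ[ℝ] D := q.liftHom
    have hbij : Function.Bijective f := by
      refine ⟨f.toRingHom.injective, fun x ↦ ?_⟩
      obtain ⟨y, w, rfl, hy, hw⟩ := exists_add_eq_commute_anticommute hi x
      have hjw : Commute (j * w) i := by
        rw [commute_iff_eq, ← mul_assoc i, hij, neg_mul, mul_assoc j i, hw]
        simp [mul_assoc]
      obtain ⟨s, t, hst⟩ := exists_eq_of_commute hD hi hy
      obtain ⟨s', t', hst'⟩ := exists_eq_of_commute hD hi hjw
      have hw' : w = -s' • j + t' • (i * j) := by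
        have : w = -(j * (j * w)) := by rw [← mul_assoc, hj]; simp
        rw [this, hst', mul_add, mul_smul_comm, mul_smul_comm, mul_one, hij]
        module
      refine ⟨⟨s, t, -s', t'⟩, ?_⟩
      change algebraMap ℝ D s + t • i + (-s') • j + t' • (i * j) = y + w
      rw [hst, hw', Algebra.algebraMap_eq_smul_one]
      abel
    exact ⟨(AlgEquiv.ofBijective f hbij).symm.toAlgHom⟩
  · push Not at hanti
    have hbij : Function.Bijective (Complex.liftAux i hi) := by
      refine ⟨(Complex.liftAux i hi).toRingHom.injective, fun x ↦ ?_⟩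
      obtain ⟨y, w, rfl, hy, hw⟩ := exists_add_eq_commute_anticommute hi x
      obtain ⟨s, t, hst⟩ := exists_eq_of_commute hD hi hy
      have hw0 : w = 0 := by
        by_contra h
        exact hanti w h hw
      refine ⟨⟨s, t⟩, ?_⟩
      simp [Complex.liftAux_apply, hst, hw0, Algebra.algebraMap_eq_smul_one]
    exact ⟨Quaternion.ofComplex.comp (AlgEquiv.ofBijective _ hbij).symm.toAlgHom⟩

end Frobenius

theorem notMem_spectrum_of_isUnit_quadratic {B : Type*} [Ring B] [Algebra ℂ B] {b : B} {z : ℂ}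
    (h : IsUnit (b * b - (2 * z.re : ℂ) • b + (z.re ^ 2 + z.im ^ 2 : ℂ) • (1 : B))) :
    z ∉ spectrum ℂ b := by
  have hadd : (2 * z.re : ℂ) = z + star z := by simp [Complex.ext_iff, two_mul]
  have hmul : (z.re ^ 2 + z.im ^ 2 : ℂ) = z * star z := by
    simp [Complex.ext_iff, ← Complex.ofReal_pow]; grind
  have hfactor : (z • 1 - b) * (star z • 1 - b) =
      b * b - (2 * z.re : ℂ) • b + (z.re ^ 2 + z.im ^ 2 : ℂ) • (1 : B) := by
    rw [hadd, hmul]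
    simp only [sub_mul, mul_sub, smul_mul_assoc, mul_smul_comm, one_mul, mul_one]
    module
  have hcomm : Commute (z • 1 - b) (star z • 1 - b) :=
    (((Commute.one_left _).smul_left z).sub_left
      ((Commute.one_right b).smul_right (star z))).sub_right
        (((Commute.one_left b).smul_left z).sub_left rfl)
  rw [spectrum.notMem_iff, Algebra.algebraMap_eq_smul_one]
  rw [← hfactor] at h
  exact (hcomm.isUnit_mul_iff.mp h).1

/-- The real form of the nonemptiness of the spectrum of a bounded operator. -/
theorem exists_not_isUnit_quadratic {V : Type*} [NormedAddCommGroup V] [NormedSpace ℝ V]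
    [Nontrivial V] (T : V →L[ℝ] V) :
    ∃ s t : ℝ, ¬ IsUnit (T * T - (2 * s) • T + (s ^ 2 + t ^ 2) • (1 : V →L[ℝ] V)) := by
  let P (S : V →L[ℝ] V) : (V →L[ℝ] ℂ) →L[ℂ] (V →L[ℝ] ℂ) :=
    LinearMap.mkContinuous
      { toFun := fun φ ↦ φ.comp S
        map_add' := fun _ _ ↦ rfl
        map_smul' := fun _ _ ↦ rfl } ‖S‖
      (fun φ ↦ (φ.opNorm_comp_le S).trans_eq (mul_comm _ _))
  have hP (S S' : V →L[ℝ] V) : P S * P S' = P (S' * S) := rfl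
  have hP1 : P 1 = 1 := rfl
  have : Nontrivial (V →L[ℝ] ℂ) := by
    obtain ⟨v, hv⟩ := exists_ne (0 : V)
    obtain ⟨f, hf⟩ := SeparatingDual.exists_ne_zero (R := ℝ) hv
    refine ⟨Complex.ofRealCLM.comp f, 0, fun h ↦ hf ?_⟩
    simpa using congr($h v)
  obtain ⟨z, hz⟩ := spectrum.nonempty (P T)
  refine ⟨z.re, z.im, fun hu ↦ notMem_spectrum_of_isUnit_quadratic ?_ hz⟩
  have hquad : P T * P T - (2 * z.re : ℂ) • P T + (z.re ^ 2 + z.im ^ 2 : ℂ) • 1 =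
      P (T * T - (2 * z.re) • T + (z.re ^ 2 + z.im ^ 2) • (1 : V →L[ℝ] V)) := by
    ext φ v
    simp [P]
    rfl
  rw [hquad]
  obtain ⟨R, hR, hR'⟩ := isUnit_iff_exists.mp hu
  exact isUnit_iff_exists.mpr ⟨P R, by rw [hP, hR', hP1], by rw [hP, hR, hP1]⟩

section Banach

variable {A : Type*} [NormedRing A]

theorem norm_units_conj_le {r : A → ℝ}
    (hr : ∀ a : A, Tendsto (fun n : ℕ => ‖a ^ n‖ ^ (1 / (n : ℝ))) atTop (nhds (r a)))
    {m : ℝ} (hm : 0 < m) (hnorm : ∀ a : A, ‖a‖ ≤ m * r a) (u : Aˣ) (b : A) :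
    ‖(u : A) * b * (↑u⁻¹ : A)‖ ≤ m * r b := by
  refine (hnorm _).trans (mul_le_mul_of_nonneg_left ?_ hm.le)
  set C : ℝ := ‖(u : A)‖ * ‖(↑u⁻¹ : A)‖ + 1 with hC
  have hC0 : 0 < C := by positivity
  have hC1 : Tendsto (fun n : ℕ ↦ C ^ (1 / (n : ℝ))) atTop (nhds 1) := by
    simpa [Function.comp_def] using (Real.continuousAt_const_rpow hC0.ne').tendsto.comp
      tendsto_one_div_atTop_nhds_zero_nat
  have hlim := hC1.mul (hr b)
  rw [one_mul] at hlim
  refine le_of_tendsto_of_tendsto' (hr _) hlim fun n ↦ ?_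
  rw [← Real.mul_rpow hC0.le (norm_nonneg _), Units.conj_pow]
  refine Real.rpow_le_rpow (norm_nonneg _) ?_ (by positivity)
  calc ‖(u : A) * b ^ n * (↑u⁻¹ : A)‖ ≤ ‖(u : A)‖ * ‖b ^ n‖ * ‖(↑u⁻¹ : A)‖ :=
        (norm_mul_le _ _).trans (by gcongr; exact norm_mul_le _ _)
    _ = (‖(u : A)‖ * ‖(↑u⁻¹ : A)‖) * ‖b ^ n‖ := by ring
    _ ≤ C * ‖b ^ n‖ := by gcongr; simp [hC]

variable [NormedAlgebra ℝ A]

/-- Left multiplication on the quotient by a closed left ideal. -/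
noncomputable def Ideal.quotientLsmul (M : Ideal A) [IsClosed (M : Set A)] :
    A →ₐ[ℝ] ((A ⧸ M) →L[ℝ] (A ⧸ M)) where
  toFun a := LinearMap.mkContinuous
    { toFun := fun v ↦ a • v
      map_add' := smul_add a
      map_smul' := fun c v ↦ smul_comm a c v } ‖a‖ (fun v ↦ by
        refine le_of_forall_pos_le_add fun ε hε ↦ ?_
        have hδ : 0 < ε / (‖a‖ + 1) := by positivity
        obtain ⟨x, rfl, hx⟩ := Submodule.Quotient.norm_mk_lt v hδ
        calc ‖Submodule.Quotient.mk (p := M) (a * x)‖ ≤ ‖a * x‖ :=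
              Submodule.Quotient.norm_mk_le M _
          _ ≤ ‖a‖ * ‖x‖ := norm_mul_le _ _
          _ ≤ ‖a‖ * (‖Submodule.Quotient.mk (p := M) x‖ + ε / (‖a‖ + 1)) := by gcongr
          _ = ‖a‖ * ‖Submodule.Quotient.mk (p := M) x‖ + ‖a‖ / (‖a‖ + 1) * ε := by ring
          _ ≤ ‖a‖ * ‖Submodule.Quotient.mk (p := M) x‖ + 1 * ε := by
              gcongr
              rw [div_le_one (by positivity)]
              linarith
          _ = _ := by rw [one_mul])
  map_one' := by ext v; exact one_smul A v
  map_mul' a b := by ext v; exact mul_smul a b v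
  map_zero' := by ext v; exact zero_smul A v
  map_add' a b := by ext v; exact add_smul a b v
  commutes' c := by ext v; exact algebraMap_smul A c v

theorem Ideal.IsMaximal.exists_quadratic_mem [CompleteSpace A] (M : Ideal A) [hM : M.IsMaximal]
    [M.IsTwoSided] (a : A) :
    ∃ s t : ℝ, a * a - (2 * s) • a + (s ^ 2 + t ^ 2) • (1 : A) ∈ M := by
  have : Nontrivial (A ⧸ M) := Submodule.Quotient.nontrivial_iff.mpr hM.ne_top
  obtain ⟨s, t, hst⟩ := exists_not_isUnit_quadratic (M.quotientLsmul a)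
  refine ⟨s, t, ?_⟩
  by_contra hq
  refine hst ?_
  have hL0 : ∀ i ∈ M, M.quotientLsmul i = 0 := by
    intro i hi
    ext v
    obtain ⟨x, rfl⟩ := Submodule.Quotient.mk_surjective _ v
    exact (Submodule.Quotient.mk_eq_zero M).mpr (M.mul_mem_right x hi)
  have hinv : ∀ x ∉ M, ∃ y, M.quotientLsmul y * M.quotientLsmul x = 1 := by
    intro x hx
    obtain ⟨y, i, hi, h⟩ := hM.exists_inv hx
    refine ⟨y, ?_⟩
    simpa [hL0 i hi] using congr(M.quotientLsmul $h)
  obtain ⟨y, hy⟩ := hinv _ hq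
  have hyM : y ∉ M := by
    intro h
    rw [hL0 y h, zero_mul] at hy
    exact zero_ne_one hy
  obtain ⟨z, hz⟩ := hinv y hyM
  rw [left_inv_eq_right_inv hz hy] at hz
  simpa using isUnit_iff_exists.mpr ⟨_, hz, hy⟩

theorem Ideal.IsMaximal.isTwoSided_of_units_conj_bounded [CompleteSpace A]
    (hbdd : ∀ b : A, ∃ K : ℝ, ∀ u : Aˣ, ‖(u : A) * b * (↑u⁻¹ : A)‖ ≤ K)
    (M : Ideal A) [hM : M.IsMaximal] : M.IsTwoSided := by
  refine ⟨fun {d} b hd ↦ ?_⟩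
  by_contra hdb
  obtain ⟨y, i, hi, hyi⟩ := hM.exists_inv hdb
  set p : A := b * y * d with hp
  have hpM : p ∈ M := M.mul_mem_left _ hd
  have hpb : p * b - b ∈ M := by
    have : p * b - b = -(b * i) := by
      rw [hp, eq_sub_of_add_eq' hyi]
      noncomm_ring
    rw [this]
    exact M.neg_mem (M.mul_mem_left _ hi)
  have hsmul : ∀ (c : ℝ) {x : A}, x ∈ M → c • x ∈ M := fun c x hx ↦
    M.smul_of_tower_mem c hx
  obtain ⟨ε, hε, hεp⟩ : ∃ ε : ℝ, 0 < ε ∧ ‖-(ε • p)‖ < 1 := by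
    refine ⟨(‖p‖ + 1)⁻¹, by positivity, ?_⟩
    rw [norm_neg, norm_smul, norm_inv, Real.norm_of_nonneg (by positivity), inv_mul_lt_one₀
      (by positivity)]
    linarith
  let u : Aˣ := Units.oneSub _ hεp
  have hu : (u : A) = 1 + ε • p := by simp [u]
  have hpow (n : ℕ) : (u : A) ^ n - 1 ∈ M := by
    rw [← geom_sum_mul, hu, add_sub_cancel_left]
    exact M.mul_mem_left _ (hsmul ε hpM)
  have hpowb (n : ℕ) : (u : A) ^ n * b - (1 + ε) ^ n • b ∈ M := by
    induction n with
    | zero => simp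
    | succ n ih =>
      have : (u : A) ^ (n + 1) * b - (1 + ε) ^ (n + 1) • b =
          ε • ((u : A) ^ n * (p * b - b)) + (1 + ε) • ((u : A) ^ n * b - (1 + ε) ^ n • b) := by
        rw [pow_succ (u : A), mul_assoc]
        nth_rewrite 2 [hu]
        simp only [add_mul, mul_sub, mul_add, one_mul, smul_mul_assoc, mul_smul_comm]
        module
      rw [this]
      exact M.add_mem (hsmul _ (M.mul_mem_left _ hpb)) (hsmul _ ih)
  let w (n : ℕ) : A := (↑(u ^ n) : A) * b * (↑(u ^ n)⁻¹ : A)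
  have hw (n : ℕ) : w n - (1 + ε) ^ n • b ∈ M := by
    have : w n - (1 + ε) ^ n • b =
        ((u : A) ^ n * b - (1 + ε) ^ n • b) - w n * ((u : A) ^ n - 1) := by
      have h : w n * (u : A) ^ n = (u : A) ^ n * b := by
        rw [← Units.val_pow_eq_pow_val]
        simp only [w, Units.inv_mul_cancel_right]
      rw [mul_sub, h]
      noncomm_ring
    rw [this]
    exact M.sub_mem (hpowb n) (M.mul_mem_left _ (hpow n))
  obtain ⟨K, hK⟩ := hbdd b
  have hlim : Tendsto (fun n ↦ ((1 + ε) ^ n)⁻¹ • w n) atTop (nhds 0) := by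
    have h0 : Tendsto (fun n : ℕ ↦ ((1 + ε) ^ n)⁻¹ * K) atTop (nhds 0) := by
      simpa using (tendsto_inv_atTop_zero.comp
        (tendsto_pow_atTop_atTop_of_one_lt (by linarith : 1 < 1 + ε))).mul_const K
    refine squeeze_zero_norm (fun n ↦ ?_) h0
    rw [norm_smul, Real.norm_of_nonneg (by positivity)]
    gcongr
    exact hK (u ^ n)
  have hbM : b ∈ M := by
    refine (Ideal.IsMaximal.isClosed (I := M)).mem_of_tendsto
      (by simpa using hlim.const_sub b) (Eventually.of_forall fun n ↦ ?_)
    have hne : (1 + ε) ^ n ≠ 0 := by positivity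
    have : b - ((1 + ε) ^ n)⁻¹ • w n = -(((1 + ε) ^ n)⁻¹ • (w n - (1 + ε) ^ n • b)) := by
      rw [smul_sub, inv_smul_smul₀ hne]
      abel
    rw [SetLike.mem_coe, this]
    exact M.neg_mem (hsmul _ (hw n))
  exact hdb (M.mul_mem_left _ hbM)

theorem Ideal.IsMaximal.exists_algHom_quaternion [CompleteSpace A] (M : Ideal A) [hM : M.IsMaximal]
    [M.IsTwoSided] : ∃ x : A →ₐ[ℝ] ℍ[ℝ], ∀ a ∈ M, x a = 0 := by
  have : Nontrivial (A ⧸ M) := Submodule.Quotient.nontrivial_iff.mpr hM.ne_top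
  have : NoZeroDivisors (A ⧸ M) := by
    refine ⟨fun {a b} hab ↦ ?_⟩
    obtain ⟨a, rfl⟩ := Ideal.Quotient.mk_surjective a
    obtain ⟨b, rfl⟩ := Ideal.Quotient.mk_surjective b
    rw [← map_mul, Ideal.Quotient.eq_zero_iff_mem] at hab
    simp only [Ideal.Quotient.eq_zero_iff_mem]
    by_contra! h
    obtain ⟨y, i, hi, hyi⟩ := hM.exists_inv h.1
    have : b = y * (a * b) + i * b := by rw [← mul_assoc, ← add_mul, hyi, one_mul]
    exact h.2 (this ▸ M.add_mem (M.mul_mem_left _ hab) (M.mul_mem_right _ hi))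
  obtain ⟨f⟩ := nonempty_algHom_quaternion (D := A ⧸ M) fun x ↦ by
    obtain ⟨a, rfl⟩ := Ideal.Quotient.mkₐ_surjective ℝ M x
    obtain ⟨s, t, h⟩ := Ideal.IsMaximal.exists_quadratic_mem M a
    refine ⟨s, t, ?_⟩
    simpa only [map_add, map_sub, map_mul, map_smul, map_one] using
      (show Ideal.Quotient.mkₐ ℝ M _ = 0 from Ideal.Quotient.eq_zero_iff_mem.mpr h)
  refine ⟨f.comp (Ideal.Quotient.mkₐ ℝ M), fun a ha ↦ ?_⟩
  have : Ideal.Quotient.mkₐ ℝ M a = 0 := Ideal.Quotient.eq_zero_iff_mem.mpr ha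
  rw [AlgHom.comp_apply, this, map_zero]

end Banach

/-- In a real unital Banach algebra whose norm is dominated by a multiple of the
spectral radius, an element is invertible iff no (unital) real-algebra
homomorphism into the quaternions kills it. -/
theorem isUnit_iff_algHom_quaternion_ne_zero
    {A : Type*} [NormedRing A] [CompleteSpace A] [NormedAlgebra ℝ A]
    (r : A → ℝ)
    (hr : ∀ a : A, Tendsto (fun n : ℕ => ‖a ^ n‖ ^ (1 / (n : ℝ))) atTop (nhds (r a)))
    (m : ℝ) (hm : 0 < m)
    (hnorm : ∀ a : A, ‖a‖ ≤ m * r a)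
    (a : A) :
    IsUnit a ↔ ∀ x : A →ₐ[ℝ] ℍ[ℝ], x a ≠ 0 := by
  refine ⟨fun ha x ↦ (ha.map x).ne_zero, fun ha ↦ ?_⟩
  have hleft : ∀ c : A, (∀ x : A →ₐ[ℝ] ℍ[ℝ], x c ≠ 0) → ∃ b, b * c = 1 := by
    intro c hc
    rw [← Ideal.mem_span_singleton', ← Ideal.eq_top_iff_one]
    by_contra htop
    obtain ⟨M, hM, hcM⟩ := Ideal.exists_le_maximal _ htop
    have := Ideal.IsMaximal.isTwoSided_of_units_conj_bounded
      (fun b ↦ ⟨m * r b, fun u ↦ norm_units_conj_le hr hm hnorm u b⟩) M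
    obtain ⟨x, hx⟩ := Ideal.IsMaximal.exists_algHom_quaternion M
    exact hc x (hx c (hcM (Ideal.mem_span_singleton_self c)))
  obtain ⟨b, hba⟩ := hleft a ha
  obtain ⟨c, hcb⟩ := hleft b fun x hxb ↦ by
    have h := congr(x $hba)
    rw [map_mul, hxb, zero_mul, map_one] at h
    exact zero_ne_one h
  have hca : c = a := by rw [← mul_one c, ← hba, ← mul_assoc, hcb, one_mul]
  exact ⟨⟨a, b, hca ▸ hcb, hba⟩, rfl⟩
end

section
/- Let B be a real unital Banach algebra (complete submultiplicative norm, with unit) and suppose there is a constant m > 0 such that ‖b‖ = m·r(b) for all b ∈ B, where r(b) = lim_{n→∞} ‖bⁿ‖^{1/n}. Then the norm |b| := m⁻¹·‖b‖ is submultiplicative: |ab| ≤ |a|·|b| for all a, b ∈ B. Equivalently, the spectral radius is submultiplicative on B: r(ab) ≤ r(a)·r(b) for all a, b ∈ B. -/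
open Filter

section Complexification

variable {A : Type*} [NormedRing A] [NormedAlgebra ℝ A]

lemma norm_comp_mul_flip_le (x : A) (f : A →L[ℝ] ℂ) :
    ‖f.comp ((ContinuousLinearMap.mul ℝ A).flip x)‖ ≤ ‖x‖ * ‖f‖ := by
  refine ContinuousLinearMap.opNorm_le_bound _ (by positivity) fun b => ?_
  calc ‖f (b * x)‖ ≤ ‖f‖ * ‖b * x‖ := f.le_opNorm _
    _ ≤ ‖f‖ * (‖b‖ * ‖x‖) := by gcongr; exact norm_mul_le _ _
    _ = ‖x‖ * ‖f‖ * ‖b‖ := by ring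

/-- The action of a real normed algebra on its complex-valued real-linear functionals by
precomposition with right multiplication. -/
noncomputable def functionalAction :
    A →ₐ[ℝ] ((A →L[ℝ] ℂ) →L[ℂ] (A →L[ℝ] ℂ)) :=
  AlgHom.ofLinearMap
    { toFun := fun x => LinearMap.mkContinuous
        { toFun := fun f => f.comp ((ContinuousLinearMap.mul ℝ A).flip x)
          map_add' := fun f g => by ext; simp
          map_smul' := fun c f => by ext; simp }
        ‖x‖ (norm_comp_mul_flip_le x)
      map_add' := fun x y => by ext f b; simp
      map_smul' := fun c x => by ext f b; simp }
    (by ext f b; simp)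
    (fun x y => by ext f b; simp [mul_assoc])

@[simp]
lemma functionalAction_apply (x : A) (f : A →L[ℝ] ℂ) (b : A) :
    functionalAction x f b = f (b * x) := rfl

lemma norm_functionalAction_le (x : A) : ‖functionalAction x‖ ≤ ‖x‖ :=
  ContinuousLinearMap.opNorm_le_bound _ (norm_nonneg x) (norm_comp_mul_flip_le x)

lemma norm_le_norm_one_mul_norm_functionalAction (x : A) :
    ‖x‖ ≤ ‖(1 : A)‖ * ‖functionalAction x‖ := by
  rcases eq_or_ne x 0 with rfl | hx
  · rw [norm_zero]; exact mul_nonneg (norm_nonneg _) (norm_nonneg (functionalAction (0 : A)))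
  obtain ⟨g, hg, hgx⟩ := exists_dual_vector ℝ x (norm_ne_zero_iff.mpr hx)
  let f : A →L[ℝ] ℂ := Complex.ofRealCLM.comp g
  have hf : ‖f‖ ≤ 1 :=
    (ContinuousLinearMap.opNorm_comp_le _ _).trans (by simp [hg])
  have hfx : ‖functionalAction x f 1‖ = ‖x‖ := by simp [f, hgx]
  calc ‖x‖ = ‖functionalAction x f 1‖ := hfx.symm
    _ ≤ ‖functionalAction x f‖ * ‖(1 : A)‖ := ContinuousLinearMap.le_opNorm _ _
    _ ≤ ‖functionalAction x‖ * 1 * ‖(1 : A)‖ := by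
        gcongr
        exact (ContinuousLinearMap.le_opNorm _ _).trans (by gcongr)
    _ = _ := by ring

lemma notMem_spectrum_of_isUnit_sq_add_sq {R : Type*} [Ring R] [Algebra ℂ R] [Algebra ℝ R]
    [IsScalarTower ℝ ℂ R] {T : R} {z : ℂ}
    (h : IsUnit ((T - algebraMap ℝ R z.re) ^ 2 + algebraMap ℝ R (z.im ^ 2))) :
    z ∉ spectrum ℂ T := by
  have hfactor : (T - algebraMap ℝ R z.re) ^ 2 + algebraMap ℝ R (z.im ^ 2) =
      (algebraMap ℂ R z - T) * (algebraMap ℂ R (starRingEnd ℂ z) - T) := by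
    rw [IsScalarTower.algebraMap_apply ℝ ℂ R, IsScalarTower.algebraMap_apply ℝ ℂ R]
    simp only [Algebra.algebraMap_eq_smul_one, sq, sub_mul, mul_sub, smul_mul_assoc,
      mul_smul_comm, one_mul, mul_one]
    match_scalars <;> apply Complex.ext <;> (simp; try ring)
  rw [hfactor] at h
  have hc : Commute (algebraMap ℂ R z - T) (algebraMap ℂ R (starRingEnd ℂ z) - T) :=
    (Algebra.commute_algebraMap_left _ _).sub_left
      ((Algebra.commute_algebraMap_right _ _).sub_right (Commute.refl T))
  rw [spectrum.mem_iff, not_not]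
  exact (hc.isUnit_mul_iff.mp h).1

lemma tendsto_const_rpow_one_div_natCast {c : ℝ} (hc : 0 < c) :
    Tendsto (fun n : ℕ => c ^ (1 / (n : ℝ))) atTop (nhds 1) := by
  simpa using (tendsto_const_nhds (x := c)).rpow tendsto_one_div_atTop_nhds_zero_nat
    (Or.inl hc.ne')

/-- Every element `x` of a real Banach algebra has a spectral value `α + iβ` whose modulus
is the limit in the spectral radius formula. -/
lemma exists_tendsto_norm_pow_and_not_isUnit [Nontrivial A] (x : A) :
    ∃ ρ α β : ℝ, Tendsto (fun n : ℕ => ‖x ^ n‖ ^ (1 / (n : ℝ))) atTop (nhds ρ) ∧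
      0 ≤ ρ ∧ α ^ 2 + β ^ 2 = ρ ^ 2 ∧
      ¬ IsUnit ((x - algebraMap ℝ A α) ^ 2 + algebraMap ℝ A (β ^ 2)) := by
  have h1 : 0 < ‖(1 : A)‖ := norm_pos_iff.mpr one_ne_zero
  have : Nontrivial (A →L[ℝ] ℂ) := by
    obtain ⟨g, -, hg⟩ := exists_dual_vector ℝ (1 : A) h1.ne'
    refine ⟨Complex.ofRealCLM.comp g, 0, fun h => h1.ne' ?_⟩
    simpa [hg] using congrArg (fun f => f (1 : A)) h
  obtain ⟨z, hz, hzr⟩ := spectrum.exists_nnnorm_eq_spectralRadius (functionalAction x)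
  have hlim : Tendsto (fun n : ℕ => ‖functionalAction (x ^ n)‖ ^ (1 / (n : ℝ))) atTop
      (nhds ‖z‖) := by
    have h := spectrum.pow_norm_pow_one_div_tendsto_nhds_spectralRadius (functionalAction x)
    rw [← hzr] at h
    have h' := (ENNReal.tendsto_toReal ENNReal.coe_ne_top).comp h
    refine Tendsto.congr (fun n => ?_) h'
    rw [map_pow]
    exact ENNReal.toReal_ofReal (Real.rpow_nonneg (norm_nonneg (functionalAction x ^ n)) _)
  refine ⟨‖z‖, z.re, z.im, ?_, norm_nonneg _, ?_, fun hu => ?_⟩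
  · refine tendsto_of_tendsto_of_tendsto_of_le_of_le hlim
      (by simpa only [one_mul] using (tendsto_const_rpow_one_div_natCast h1).mul hlim)
      (fun n => ?_) (fun n => ?_)
    · exact Real.rpow_le_rpow (norm_nonneg (functionalAction (x ^ n)))
        (norm_functionalAction_le _) (by positivity)
    · dsimp only
      rw [← Real.mul_rpow (norm_nonneg _) (norm_nonneg (functionalAction (x ^ n)))]
      exact Real.rpow_le_rpow (norm_nonneg _) (norm_le_norm_one_mul_norm_functionalAction _)
        (by positivity)
  · rw [← Complex.normSq_eq_norm_sq, Complex.normSq_apply]; ring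
  · refine notMem_spectrum_of_isUnit_sq_add_sq (T := functionalAction x) ?_ hz
    have hu' := hu.map (functionalAction (A := A))
    rwa [map_add, map_pow, map_sub, AlgHom.commutes, AlgHom.commutes] at hu'

end Complexification

section Division

variable {D : Type*} [NormedRing D] [NormedAlgebra ℝ D]

lemma sq_sub_algebraMap_add_eq_zero_iff (w : D) (α β : ℝ) :
    (w - algebraMap ℝ D α) ^ 2 + algebraMap ℝ D (β ^ 2) = 0 ↔
      w * w = (2 * α) • w - (α ^ 2 + β ^ 2) • (1 : D) := by
  have : (w - algebraMap ℝ D α) ^ 2 + algebraMap ℝ D (β ^ 2) =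
      w * w - ((2 * α) • w - (α ^ 2 + β ^ 2) • (1 : D)) := by
    simp only [Algebra.algebraMap_eq_smul_one, sq, sub_mul, mul_sub, smul_mul_assoc,
      mul_smul_comm, one_mul, mul_one]
    module
  rw [this, sub_eq_zero]

lemma quadratic_coeffs_unique [Nontrivial D] {w : D} {s n s' n' : ℝ}
    (h : w * w = s • w - n • (1 : D)) (h' : w * w = s' • w - n' • (1 : D))
    (hw : ∀ c : ℝ, w ≠ c • (1 : D)) : n = n' := by
  have e : (s - s') • w = (n - n') • (1 : D) := by
    have := h.symm.trans h'
    rw [sub_smul, sub_smul, sub_eq_sub_iff_add_eq_add]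
    rw [sub_eq_sub_iff_add_eq_add] at this
    rw [this, add_comm]
  by_cases hs : s - s' = 0
  · rw [hs, zero_smul, eq_comm, smul_eq_zero] at e
    exact sub_eq_zero.mp (e.resolve_right one_ne_zero)
  · refine absurd ?_ (hw ((s - s')⁻¹ * (n - n')))
    rw [mul_smul, ← e, inv_smul_smul₀ hs]

lemma sq_add_sq_unique [Nontrivial D] {w : D} {α β α' β' : ℝ}
    (h : w * w = (2 * α) • w - (α ^ 2 + β ^ 2) • (1 : D))
    (h' : w * w = (2 * α') • w - (α' ^ 2 + β' ^ 2) • (1 : D)) :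
    α ^ 2 + β ^ 2 = α' ^ 2 + β' ^ 2 := by
  by_cases hw : ∀ c : ℝ, w ≠ c • (1 : D)
  · exact quadratic_coeffs_unique h h' hw
  · push Not at hw
    obtain ⟨c, rfl⟩ := hw
    have aux (α β : ℝ) (h : c • (1 : D) * c • (1 : D) =
        (2 * α) • c • (1 : D) - (α ^ 2 + β ^ 2) • (1 : D)) : α ^ 2 + β ^ 2 = c ^ 2 := by
      have h0 : ((c - α) ^ 2 + β ^ 2) • (1 : D) = 0 := by
        rw [smul_mul_smul_comm, one_mul] at h
        linear_combination (norm := module) h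
      have h1 : (c - α) ^ 2 + β ^ 2 = 0 := (smul_eq_zero.mp h0).resolve_right one_ne_zero
      have h2 : c - α = 0 := by nlinarith [sq_nonneg (c - α), sq_nonneg β]
      have h3 : β = 0 := by nlinarith [sq_nonneg (c - α), sq_nonneg β]
      rw [h3, sub_eq_zero.mp h2]; ring
    rw [aux _ _ h, aux _ _ h']

/-- In an algebra all of whose elements are quadratic, two elements with scalar squares
either commute or anticommute up to a scalar. -/
lemma commute_or_add_eq_smul_one (hq : ∀ w : D, ∃ s n : ℝ, w * w = s • w - n • (1 : D))
    {u v : D} {p q : ℝ} (hu : u * u = p • (1 : D)) (hv : v * v = q • (1 : D)) :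
    Commute u v ∨ ∃ c : ℝ, u * v + v * u = c • (1 : D) := by
  obtain ⟨s, n, h⟩ := hq (u + v)
  have e : u * v + v * u = s • (u + v) - (n + p + q) • (1 : D) := by
    have : (u + v) * (u + v) = u * v + v * u + (u * u + v * v) := by noncomm_ring
    rw [this, hu, hv] at h
    linear_combination (norm := module) h
  by_cases hs : s = 0
  · exact Or.inr ⟨-(n + p + q), by rw [e, hs]; module⟩
  · left
    have h1 : u * (u * v + v * u) = (u * v + v * u) * u := by
      have e1 : u * (u * v + v * u) = (u * u) * v + u * v * u := by noncomm_ring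
      have e2 : (u * v + v * u) * u = u * v * u + v * (u * u) := by noncomm_ring
      rw [e1, e2, hu, smul_one_mul, mul_smul_one, add_comm]
    rw [e] at h1
    have h2 : s • (u * v) = s • (v * u) := by
      simp only [mul_sub, sub_mul, mul_smul_comm, smul_mul_assoc, mul_add, add_mul, mul_one,
        one_mul, smul_add] at h1
      linear_combination (norm := module) h1
    change u * v = v * u
    simpa [inv_smul_smul₀ hs] using congrArg (s⁻¹ • ·) h2

omit [NormedAlgebra ℝ D] in
lemma Commute.le_mul_of_tendsto_norm_pow {x y : D} (hxy : Commute x y) {a b c : ℝ}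
    (ha : Tendsto (fun n : ℕ => ‖x ^ n‖ ^ (1 / (n : ℝ))) atTop (nhds a))
    (hb : Tendsto (fun n : ℕ => ‖y ^ n‖ ^ (1 / (n : ℝ))) atTop (nhds b))
    (hc : Tendsto (fun n : ℕ => ‖(x * y) ^ n‖ ^ (1 / (n : ℝ))) atTop (nhds c)) :
    c ≤ a * b := by
  refine le_of_tendsto_of_tendsto' hc (ha.mul hb) fun n => ?_
  rw [← Real.mul_rpow (norm_nonneg _) (norm_nonneg _), hxy.mul_pow]
  exact Real.rpow_le_rpow (norm_nonneg _) (norm_mul_le _ _) (by positivity)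

lemma sq_add_sq_eq_of_tendsto [Nontrivial D] (hD : ∀ x : D, x ≠ 0 → IsUnit x) {x : D} {a : ℝ}
    (ha : Tendsto (fun n : ℕ => ‖x ^ n‖ ^ (1 / (n : ℝ))) atTop (nhds a)) :
    0 ≤ a ∧ ∃ α β : ℝ, α ^ 2 + β ^ 2 = a ^ 2 ∧
      x * x = (2 * α) • x - (α ^ 2 + β ^ 2) • (1 : D) := by
  obtain ⟨ρ, α, β, hρ, hρ0, h, hu⟩ := exists_tendsto_norm_pow_and_not_isUnit x
  obtain rfl := tendsto_nhds_unique ha hρ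
  refine ⟨hρ0, α, β, h, (sq_sub_algebraMap_add_eq_zero_iff _ _ _).mp ?_⟩
  by_contra h0
  exact hu (hD _ h0)

/-- The spectral radius is submultiplicative on a real normed division algebra. -/
lemma le_mul_of_tendsto_norm_pow [Nontrivial D] (hD : ∀ x : D, x ≠ 0 → IsUnit x)
    {x y : D} {a b c : ℝ}
    (ha : Tendsto (fun n : ℕ => ‖x ^ n‖ ^ (1 / (n : ℝ))) atTop (nhds a))
    (hb : Tendsto (fun n : ℕ => ‖y ^ n‖ ^ (1 / (n : ℝ))) atTop (nhds b))
    (hc : Tendsto (fun n : ℕ => ‖(x * y) ^ n‖ ^ (1 / (n : ℝ))) atTop (nhds c)) :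
    c ≤ a * b := by
  by_cases hxy : Commute x y
  · exact hxy.le_mul_of_tendsto_norm_pow ha hb hc
  obtain ⟨ha0, α, β, hα, hx⟩ := sq_add_sq_eq_of_tendsto hD ha
  obtain ⟨hb0, γ, δ, hγ, hy⟩ := sq_add_sq_eq_of_tendsto hD hb
  obtain ⟨hc0, ε, ζ, hε, hz⟩ := sq_add_sq_eq_of_tendsto hD hc
  have hq (w : D) : ∃ s n : ℝ, w * w = s • w - n • (1 : D) := by
    obtain ⟨ρ, -, -, hρ, -⟩ := exists_tendsto_norm_pow_and_not_isUnit w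
    obtain ⟨-, α, β, -, h⟩ := sq_add_sq_eq_of_tendsto hD hρ
    exact ⟨_, _, h⟩
  have hsq {w : D} {s t : ℝ} (h : w * w = (2 * s) • w - (s ^ 2 + t ^ 2) • (1 : D)) :
      (w - s • (1 : D)) * (w - s • (1 : D)) = (-t ^ 2) • (1 : D) := by
    simp only [sub_mul, mul_sub, smul_mul_assoc, mul_smul_comm, one_mul, mul_one, h]
    module
  obtain ⟨k, hk⟩ := (commute_or_add_eq_smul_one hq (hsq hx) (hsq hy)).resolve_left fun h => by
    apply hxy
    have h1 : Commute (x - α • (1 : D)) y := by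
      simpa using h.add_right ((Commute.one_right _).smul_right γ)
    simpa using h1.add_left ((Commute.one_left _).smul_left α)
  have hyx : y * x = (2 * α) • y + (2 * γ) • x + (k - 2 * α * γ) • (1 : D) - x * y := by
    simp only [sub_mul, mul_sub, smul_mul_assoc, mul_smul_comm, one_mul, mul_one] at hk
    linear_combination (norm := module) hk
  have hz' : (x * y) * (x * y) =
      (k + 2 * α * γ) • (x * y) - ((α ^ 2 + β ^ 2) * (γ ^ 2 + δ ^ 2)) • (1 : D) := by
    have e : (x * y) * (x * y) = x * (y * x) * y := by noncomm_ring
    have e1 : x * (x * y) * y = (x * x) * (y * y) := by noncomm_ring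
    have e2 : x * y * y = x * (y * y) := by noncomm_ring
    rw [e, hyx]
    simp only [mul_sub, sub_mul, mul_add, add_mul, mul_smul_comm, smul_mul_assoc, mul_one]
    rw [e1, e2, hx, hy]
    simp only [mul_sub, sub_mul, mul_smul_comm, smul_mul_assoc, mul_one, one_mul]
    module
  have hreal (t : ℝ) : x * y ≠ t • (1 : D) := fun h => by
    have hy0 : y ≠ 0 := fun h0 => hxy (h0 ▸ Commute.zero_right x)
    apply hxy
    refine (hD y hy0).mul_left_injective ?_
    change x * y * y = y * x * y
    rw [mul_assoc y x y, h, smul_one_mul, mul_smul_one]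
  have hn := quadratic_coeffs_unique hz hz' hreal
  rw [hε, hα, hγ, ← mul_pow] at hn
  exact (pow_le_pow_iff_left₀ hc0 (mul_nonneg ha0 hb0) two_ne_zero).mp hn.le

end Division

section MaximalLeftIdeal

variable {B : Type*}

lemma Ideal.IsMaximal.exists_mul_sub_one_mem [Ring B] {L : Ideal B} (hL : L.IsMaximal) {d : B}
    (hd : d ∉ L) : ∃ y : B, y * d - 1 ∈ L := by
  have htop : Ideal.span {d} ⊔ L = ⊤ := by
    refine hL.1.2 _ (lt_of_le_of_ne le_sup_right fun h => hd ?_)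
    rw [h]
    exact Ideal.mem_sup_left (Ideal.mem_span_singleton_self d)
  obtain ⟨p, hp, q, hq, hpq⟩ := Submodule.mem_sup.mp ((Ideal.eq_top_iff_one _).mp htop)
  obtain ⟨y, rfl⟩ := Submodule.mem_span_singleton.mp hp
  refine ⟨y, ?_⟩
  have : y * d - 1 = -q := by rw [← hpq, smul_eq_mul]; abel
  rw [this]
  exact L.neg_mem hq

/-- If every maximal left ideal is two-sided, every non-unit lies in a maximal left ideal. -/
lemma exists_isMaximal_mem_of_not_isUnit [Ring B]
    (h : ∀ L : Ideal B, L.IsMaximal → L.IsTwoSided) {d : B} (hd : ¬ IsUnit d) :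
    ∃ L : Ideal B, L.IsMaximal ∧ d ∈ L := by
  have exists_of_no_left_inv {d : B} (hd : ∀ y, y * d ≠ 1) :
      ∃ L : Ideal B, L.IsMaximal ∧ d ∈ L := by
    have hne : Ideal.span {d} ≠ ⊤ := fun htop => by
      obtain ⟨y, hy⟩ := Submodule.mem_span_singleton.mp ((Ideal.eq_top_iff_one _).mp htop)
      exact hd y hy
    obtain ⟨L, hL, hle⟩ := Ideal.exists_le_maximal _ hne
    exact ⟨L, hL, hle (Ideal.mem_span_singleton_self d)⟩
  by_cases hleft : ∀ y, y * d ≠ 1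
  · exact exists_of_no_left_inv hleft
  push Not at hleft
  obtain ⟨y, hy⟩ := hleft
  by_cases hy' : ∀ z, z * y ≠ 1
  · obtain ⟨L, hL, hyL⟩ := exists_of_no_left_inv hy'
    have := h L hL
    exact absurd ((Ideal.eq_top_iff_one L).mpr (hy ▸ L.mul_mem_right d hyL)) hL.ne_top
  · push Not at hy'
    obtain ⟨z, hz⟩ := hy'
    have hzd : z = d := left_inv_eq_right_inv hz hy
    exact absurd ⟨⟨d, y, hzd ▸ hz, hy⟩, rfl⟩ hd

/-- If the norm does not increase under inner automorphisms, maximal left ideals are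
two-sided. -/
lemma Ideal.IsMaximal.isTwoSided_of_norm_conj_le [NormedRing B] [CompleteSpace B]
    [NormedAlgebra ℝ B] (hconj : ∀ (u : Bˣ) (x : B), ‖(u : B) * x * ↑u⁻¹‖ ≤ ‖x‖)
    {L : Ideal B} (hL : L.IsMaximal) : L.IsTwoSided := by
  refine ⟨fun {a₁} c ha₁ => ?_⟩
  by_contra hac
  obtain ⟨y, hy⟩ := hL.exists_mul_sub_one_mem hac
  obtain ⟨a, ha, hac'⟩ : ∃ a ∈ L, a * c - c ∈ L := by
    refine ⟨c * y * a₁, L.mul_mem_left _ ha₁, ?_⟩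
    have : c * y * a₁ * c - c = c * (y * (a₁ * c) - 1) := by noncomm_ring
    rw [this]
    exact L.mul_mem_left _ hy
  obtain ⟨t, ht, hta⟩ : ∃ t : ℝ, 0 < t ∧ ‖-(t • a)‖ < 1 := by
    refine ⟨(‖a‖ + 1)⁻¹, by positivity, ?_⟩
    rw [norm_neg, norm_smul, norm_inv, Real.norm_of_nonneg (by positivity), inv_mul_lt_one₀
      (by positivity)]
    exact lt_add_one _
  let u : Bˣ := Units.oneSub (-(t • a)) hta
  have hu : (u : B) = 1 + t • a := by simp [u]
  have huL : (↑u⁻¹ : B) - 1 ∈ L := by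
    have : (↑u⁻¹ : B) - 1 = (-t) • (↑u⁻¹ * a) := by
      have h1 : (↑u⁻¹ : B) * (1 + t • a) = 1 := by rw [← hu]; exact u.inv_mul
      rw [mul_add, mul_one, mul_smul_comm] at h1
      rw [← h1]; module
    rw [this]
    exact L.smul_of_tower_mem _ (L.mul_mem_left _ ha)
  have hw (n : ℕ) : ∃ w : B, ‖w‖ ≤ ‖c‖ ∧ w - (1 + t) ^ n • c ∈ L := by
    induction n with
    | zero => exact ⟨c, le_rfl, by simp⟩
    | succ n ih =>
      obtain ⟨w, hwc, hwL⟩ := ih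
      refine ⟨u * w * ↑u⁻¹, (hconj u w).trans hwc, ?_⟩
      have : (u : B) * w * ↑u⁻¹ - (1 + t) ^ (n + 1) • c =
          u * w * (↑u⁻¹ - 1) + u * (w - (1 + t) ^ n • c) +
            ((1 + t) ^ n * t) • (a * c - c) := by
        rw [mul_sub (u * w : B), mul_one, mul_sub (u : B), mul_smul_comm, hu]
        simp only [add_mul, one_mul, smul_mul_assoc]
        module
      rw [this]
      exact L.add_mem (L.add_mem (L.mul_mem_left _ huL) (L.mul_mem_left _ hwL))
        (L.smul_of_tower_mem _ hac')
  choose w hwc hwL using hw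
  have hlim : Tendsto (fun n : ℕ => c - ((1 + t) ^ n)⁻¹ • w n) atTop (nhds c) := by
    have h0 : Tendsto (fun n : ℕ => ((1 + t) ^ n)⁻¹ • w n) atTop (nhds 0) := by
      refine squeeze_zero_norm (a := fun n : ℕ => ((1 + t) ^ n)⁻¹ * ‖c‖) (fun n => ?_) ?_
      · rw [norm_smul, Real.norm_of_nonneg (by positivity)]
        gcongr
        exact hwc n
      · simpa using ((tendsto_pow_atTop_atTop_of_one_lt
          (by linarith : 1 < 1 + t)).inv_tendsto_atTop).mul_const ‖c‖
    simpa using h0.const_sub c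
  have hcL : c ∈ L := by
    refine (Ideal.IsMaximal.isClosed (I := L)).mem_of_tendsto hlim (Eventually.of_forall fun n => ?_)
    have hn : (1 + t) ^ n ≠ 0 := by positivity
    have : c - ((1 + t) ^ n)⁻¹ • w n = (-((1 + t) ^ n)⁻¹) • (w n - (1 + t) ^ n • c) := by
      rw [smul_sub, smul_smul, neg_mul, inv_mul_cancel₀ hn]; module
    rw [this]
    exact L.smul_of_tower_mem _ (hwL n)
  exact hac (L.mul_mem_left _ hcL)

/-- The quotient of a normed ring by a closed two-sided ideal. -/
@[reducible]
noncomputable def Ideal.Quotient.normedRingOfIsTwoSided [NormedRing B] (L : Ideal B)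
    [L.IsTwoSided] [IsClosed (L : Set B)] : NormedRing (B ⧸ L) :=
  { Submodule.Quotient.normedAddCommGroup L, Ideal.Quotient.ring L with
    norm_mul_le := fun x y => by
      have hlim : Tendsto (fun ε : ℝ => (‖x‖ + ε) * (‖y‖ + ε)) (nhdsWithin 0 (Set.Ioi 0))
          (nhds (‖x‖ * ‖y‖)) := by
        have : Continuous fun ε : ℝ => (‖x‖ + ε) * (‖y‖ + ε) := by fun_prop
        simpa using (this.tendsto 0).mono_left nhdsWithin_le_nhds
      refine ge_of_tendsto hlim (eventually_nhdsWithin_of_forall fun ε hε => ?_)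
      obtain ⟨a, rfl, ha⟩ := Submodule.Quotient.norm_mk_lt x hε
      obtain ⟨b, rfl, hb⟩ := Submodule.Quotient.norm_mk_lt y hε
      calc ‖(Submodule.Quotient.mk (a * b) : B ⧸ L)‖ ≤ ‖a * b‖ :=
            Submodule.Quotient.norm_mk_le L _
        _ ≤ ‖a‖ * ‖b‖ := norm_mul_le a b
        _ ≤ _ := mul_le_mul ha.le hb.le (norm_nonneg b) ((norm_nonneg a).trans ha.le) }

end MaximalLeftIdeal

lemma Units.le_of_tendsto_norm_conj_pow {B : Type*} [NormedRing B] (u : Bˣ) {x : B} {s t : ℝ}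
    (hs : Tendsto (fun n : ℕ => ‖((u : B) * x * ↑u⁻¹) ^ n‖ ^ (1 / (n : ℝ))) atTop (nhds s))
    (ht : Tendsto (fun n : ℕ => ‖x ^ n‖ ^ (1 / (n : ℝ))) atTop (nhds t)) : s ≤ t := by
  have hK : 0 < ‖(u : B)‖ * ‖(↑u⁻¹ : B)‖ + 1 := by positivity
  have h := (tendsto_const_rpow_one_div_natCast hK).mul ht
  rw [one_mul] at h
  refine le_of_tendsto_of_tendsto' hs h fun n => ?_
  rw [← Real.mul_rpow hK.le (norm_nonneg _), Units.conj_pow]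
  refine Real.rpow_le_rpow (norm_nonneg _) ?_ (by positivity)
  calc ‖(u : B) * x ^ n * ↑u⁻¹‖ ≤ ‖(u : B)‖ * ‖x ^ n‖ * ‖(↑u⁻¹ : B)‖ :=
        (norm_mul_le _ _).trans (by gcongr; exact norm_mul_le _ _)
    _ ≤ (‖(u : B)‖ * ‖(↑u⁻¹ : B)‖ + 1) * ‖x ^ n‖ := by nlinarith [norm_nonneg (x ^ n)]

/-- The spectral radius is submultiplicative on a real Banach algebra all of whose maximal left
ideals are two-sided. -/
lemma le_mul_of_forall_isMaximal_isTwoSided {B : Type*} [NormedRing B] [CompleteSpace B]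
    [NormedAlgebra ℝ B] [Nontrivial B] (h : ∀ L : Ideal B, L.IsMaximal → L.IsTwoSided)
    {x y : B} {a b c : ℝ}
    (ha : Tendsto (fun n : ℕ => ‖x ^ n‖ ^ (1 / (n : ℝ))) atTop (nhds a))
    (hb : Tendsto (fun n : ℕ => ‖y ^ n‖ ^ (1 / (n : ℝ))) atTop (nhds b))
    (hc : Tendsto (fun n : ℕ => ‖(x * y) ^ n‖ ^ (1 / (n : ℝ))) atTop (nhds c)) :
    c ≤ a * b := by
  obtain ⟨c', α, β, hc', hc0, hαβ, hu⟩ := exists_tendsto_norm_pow_and_not_isUnit (x * y)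
  obtain rfl := tendsto_nhds_unique hc hc'
  obtain ⟨L, hL, hmem⟩ := exists_isMaximal_mem_of_not_isUnit h hu
  have := h L hL
  let : NormedRing (B ⧸ L) := Ideal.Quotient.normedRingOfIsTwoSided L
  let : NormedAlgebra ℝ (B ⧸ L) :=
    { Submodule.Quotient.normedSpace L ℝ, Ideal.Quotient.algebra ℝ with }
  have : Nontrivial (B ⧸ L) := Ideal.Quotient.nontrivial_iff.mpr hL.ne_top
  let π : B →ₐ[ℝ] B ⧸ L := Ideal.Quotient.mkₐ ℝ L
  have hπ (x : B) : ‖π x‖ ≤ ‖x‖ := Submodule.Quotient.norm_mk_le L x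
  have hπ0 {x : B} : π x = 0 ↔ x ∈ L := Ideal.Quotient.eq_zero_iff_mem
  have hπs : Function.Surjective π := Ideal.Quotient.mkₐ_surjective ℝ L
  have hleft (q : B ⧸ L) (hq : q ≠ 0) : ∃ p : B ⧸ L, p * q = 1 := by
    obtain ⟨d, rfl⟩ := hπs q
    obtain ⟨z, hz⟩ := hL.exists_mul_sub_one_mem (mt hπ0.mpr hq)
    refine ⟨π z, ?_⟩
    rw [← hπ0, map_sub, map_mul, map_one] at hz
    exact sub_eq_zero.mp hz
  have hD (q : B ⧸ L) (hq : q ≠ 0) : IsUnit q := by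
    obtain ⟨p, hp⟩ := hleft q hq
    obtain ⟨p', hp'⟩ := hleft p fun h0 => by simp [h0] at hp
    have hpq : p' = q := left_inv_eq_right_inv hp' hp
    exact ⟨⟨q, p, hpq ▸ hp', hp⟩, rfl⟩
  have hquot (x : B) {a : ℝ}
      (ha : Tendsto (fun n : ℕ => ‖x ^ n‖ ^ (1 / (n : ℝ))) atTop (nhds a)) :
      ∃ a' : ℝ, Tendsto (fun n : ℕ => ‖π x ^ n‖ ^ (1 / (n : ℝ))) atTop (nhds a') ∧
        0 ≤ a' ∧ a' ≤ a := by
    obtain ⟨a', -, -, ha', ha_nonneg, -⟩ := exists_tendsto_norm_pow_and_not_isUnit (π x)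
    refine ⟨a', ha', ha_nonneg, le_of_tendsto_of_tendsto' ha' ha fun n => ?_⟩
    rw [← map_pow]
    exact Real.rpow_le_rpow (norm_nonneg _) (hπ _) (by positivity)
  obtain ⟨a', ha', ha_nonneg, haa'⟩ := hquot x ha
  obtain ⟨b', hb', hb_nonneg, hbb'⟩ := hquot y hb
  obtain ⟨c', hc', hc_nonneg, -⟩ := hquot (x * y) hc
  obtain ⟨-, γ, δ, hγδ, hz⟩ := sq_add_sq_eq_of_tendsto hD hc'
  rw [← hπ0, map_add, map_pow, map_sub, AlgHom.commutes, AlgHom.commutes,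
    sq_sub_algebraMap_add_eq_zero_iff] at hmem
  have hcc' : c = c' := by
    have := sq_add_sq_unique hmem hz
    rw [hαβ, hγδ] at this
    exact (pow_left_inj₀ hc0 hc_nonneg two_ne_zero).mp this
  rw [map_mul] at hc'
  calc c = c' := hcc'
    _ ≤ a' * b' := le_mul_of_tendsto_norm_pow hD ha' hb' hc'
    _ ≤ a * b := mul_le_mul haa' hbb' hb_nonneg (ha_nonneg.trans haa')

/-- In a real unital Banach algebra with `‖b‖ = m·r(b)` for all `b`, the norm
`|b| := m⁻¹·‖b‖` is submultiplicative; equivalently, the spectral radius `r` is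
submultiplicative. -/
theorem scaled_norm_and_spectralRadius_submultiplicative
    {B : Type*} [NormedRing B] [CompleteSpace B] [NormedAlgebra ℝ B]
    (r : B → ℝ)
    (hr : ∀ b : B, Tendsto (fun n : ℕ => ‖b ^ n‖ ^ (1 / (n : ℝ))) atTop (nhds (r b)))
    (m : ℝ) (hm : 0 < m)
    (hnorm : ∀ b : B, ‖b‖ = m * r b) :
    (∀ a b : B, m⁻¹ * ‖a * b‖ ≤ (m⁻¹ * ‖a‖) * (m⁻¹ * ‖b‖)) ∧
    (∀ a b : B, r (a * b) ≤ r a * r b) := by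
  have hmul (a b : B) : r (a * b) ≤ r a * r b := by
    cases subsingleton_or_nontrivial B with
    | inl _ =>
      have h0 (x : B) : r x = 0 := by
        have h := hnorm x
        rw [Subsingleton.elim x 0, norm_zero, eq_comm] at h
        rw [Subsingleton.elim x 0]
        exact (mul_eq_zero.mp h).resolve_left hm.ne'
      simp [h0]
    | inr _ =>
      refine le_mul_of_forall_isMaximal_isTwoSided
        (fun L hL => hL.isTwoSided_of_norm_conj_le fun u x => ?_) (hr a) (hr b) (hr (a * b))
      rw [hnorm, hnorm x]
      exact mul_le_mul_of_nonneg_left (u.le_of_tendsto_norm_conj_pow (hr _) (hr x)) hm.le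
  have hrn (x : B) : m⁻¹ * ‖x‖ = r x := by rw [hnorm, inv_mul_cancel_left₀ hm.ne']
  exact ⟨fun a b => by simpa only [hrn] using hmul a b, hmul⟩
end
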